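/- Let P(ξ,η) be a real polynomial, σ := 𝓕⁻¹(e^{−iP(ξ,η)}) ∈ 𝒮′(ℝ²), let q(ξ,η) be a complex polynomial with q(ξ,η) ≠ 0 for all (ξ,η) ∈ ℝ², and set σ₁ := q(D₁,D₂)σ, i.e. 𝓕σ₁ = q·e^{−iP}. Define Q^{(σ₁)}[w] := σ₁ * Wig[w] := 𝓕⁻¹( q e^{−iP} · 𝓕(Wig[w]) ) for tempered distributions w on ℝ². Then: (i) Q^{(σ₁)} : 𝒮′(ℝ²) → 𝒮′(ℝ²) is a bijection; (ii) Q^{(σ₁)} is regular, i.e. Q^{(σ₁)}[w] ∈ 𝒮(ℝ²) implies w ∈ 𝒮(ℝ²) for every w ∈ 𝒮′(ℝ²); (iii) Q^{(σ₁)} maps 𝒮(ℝ²) into 𝒮(ℝ²). -/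

import Mathlib

/-!
STATEMENT 8. Let `P(ξ,η)` be a real polynomial, `σ = 𝓕⁻¹(e^{-iP})`, `q(ξ,η)` a complex
polynomial never vanishing on ℝ², and `σ₁ = q(D₁,D₂)σ`, i.e. `𝓕σ₁ = q·e^{-iP}`.  Define
`Q^{(σ₁)}[w] := σ₁ * Wig[w] = 𝓕⁻¹(q e^{-iP} ⬝ 𝓕(Wig[w]))` on tempered distributions.  Then:
(i) `Q^{(σ₁)} : 𝒮' → 𝒮'` is a bijection; (ii) `Q^{(σ₁)}` is regular; (iii) `Q^{(σ₁)}` maps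
`𝒮(ℝ²)` into `𝒮(ℝ²)`.

Tempered distributions are modeled as continuous linear functionals on `𝓢(ℝ², ℂ)`; the
extension of `Q^{(σ₁)}` to `𝒮'` is any continuous linear map compatible with the concrete
formula on (embedded) Schwartz functions (by density this determines it uniquely).
-/

noncomputable section
open MeasureTheory Complex SchwartzMap

abbrev Fn2 := ℝ × ℝ → ℂ

def Wig (w : Fn2) : Fn2 :=
  fun p => ∫ t : ℝ, Complex.exp (-Complex.I * t * p.2) * w (p.1 + t / 2, p.1 - t / 2)

def FT2 (f : Fn2) : Fn2 :=
  fun ξ => ∫ p : ℝ × ℝ, Complex.exp (-Complex.I * ((p.1 * ξ.1 + p.2 * ξ.2 : ℝ) : ℂ)) * f p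

def FT2inv (g : Fn2) : Fn2 :=
  fun x => ((2 * Real.pi : ℝ) : ℂ)⁻¹ ^ 2 *
    ∫ ξ : ℝ × ℝ, Complex.exp (Complex.I * ((x.1 * ξ.1 + x.2 * ξ.2 : ℝ) : ℂ)) * g ξ

def Pval (P : MvPolynomial (Fin 2) ℝ) (ξ : ℝ × ℝ) : ℝ := MvPolynomial.eval ![ξ.1, ξ.2] P

def qval (q : MvPolynomial (Fin 2) ℂ) (ξ : ℝ × ℝ) : ℂ :=
  MvPolynomial.eval ![(ξ.1 : ℂ), (ξ.2 : ℂ)] q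

/-- `Q^{(σ₁)}[w] = σ₁ * Wig[w]` with kernel `σ₁ = q(D₁,D₂)σ`, i.e. `𝓕σ₁ = q·e^{-iP}`. -/
def Qrep1 (q : MvPolynomial (Fin 2) ℂ) (P : MvPolynomial (Fin 2) ℝ) (w : Fn2) : Fn2 :=
  FT2inv (fun ξ => qval q ξ * Complex.exp (-Complex.I * ((Pval P ξ : ℝ) : ℂ)) * FT2 (Wig w) ξ)

/-- The space of tempered distributions on ℝ². -/
abbrev TD2 := 𝓢(ℝ × ℝ, ℂ) →L[ℂ] ℂ

def RepBy (u : TD2) (g : Fn2) : Prop :=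
  ∀ φ : 𝓢(ℝ × ℝ, ℂ), u φ = ∫ p : ℝ × ℝ, g p * φ p

def InSchwartz (u : TD2) : Prop := ∃ g : 𝓢(ℝ × ℝ, ℂ), RepBy u ⇑g

/-- Regularity in the sense of Shubin. -/
def RegularTD (A : TD2 → TD2) : Prop := ∀ u : TD2, InSchwartz (A u) → InSchwartz u

def ExtendsOp (A' : TD2 → TD2) (A : Fn2 → Fn2) : Prop :=
  ∀ (f : 𝓢(ℝ × ℝ, ℂ)) (u : TD2), RepBy u ⇑f → RepBy (A' u) (A ⇑f)

/-- The real-linear functional `(x, y) ↦ a x + b y` with complex values. -/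
def pairCLM (a b : ℂ) : ℝ × ℝ →L[ℝ] ℂ :=
  (ContinuousLinearMap.fst ℝ ℝ ℝ).smulRight a + (ContinuousLinearMap.snd ℝ ℝ ℝ).smulRight b

@[simp] lemma pairCLM_apply (a b : ℂ) (v : ℝ × ℝ) : pairCLM a b v = v.1 * a + v.2 * b := by
  simp [pairCLM]

/-- A family of functions on `ℝ²` closed under partial derivatives, the derivatives being given
by the action of `d₁` and `d₂` on the index set, consists of smooth functions, and the iterated
derivatives are bounded by finite sums of members of the family. -/
theorem contDiff_and_norm_iteratedFDeriv_le {M ι : Type*} [Monoid M] [MulAction M ι]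
    (S : Submonoid M) {d₁ d₂ : M} (h₁ : d₁ ∈ S) (h₂ : d₂ ∈ S) (T : ι → Fn2)
    (hT : ∀ i x, HasFDerivAt (T i) (pairCLM (T (d₁ • i) x) (T (d₂ • i) x)) x) (n : ℕ) :
    (∀ i, ContDiff ℝ n (T i)) ∧ ∃ l : List M, (∀ m ∈ l, m ∈ S) ∧ ∀ i x,
      ‖iteratedFDeriv ℝ n (T i) x‖ ≤ (l.map fun m => ‖T (m • i) x‖).sum := by
  induction n with
  | zero =>
    refine ⟨fun i => ?_, [1], by simp, by simp⟩
    exact_mod_cast contDiff_zero.2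
      (continuous_iff_continuousAt.2 fun x => (hT i x).continuousAt)
  | succ n ih =>
    obtain ⟨hc, l, hl, hb⟩ := ih
    let J₁ : ℂ →L[ℝ] (ℝ × ℝ →L[ℝ] ℂ) :=
      ContinuousLinearMap.smulRightL ℝ (ℝ × ℝ) ℂ (ContinuousLinearMap.fst ℝ ℝ ℝ)
    let J₂ : ℂ →L[ℝ] (ℝ × ℝ →L[ℝ] ℂ) :=
      ContinuousLinearMap.smulRightL ℝ (ℝ × ℝ) ℂ (ContinuousLinearMap.snd ℝ ℝ ℝ)
    have hJ₁ : ‖J₁‖ ≤ 1 := by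
      refine ContinuousLinearMap.opNorm_le_bound _ zero_le_one fun c => ?_
      rw [show J₁ c = (ContinuousLinearMap.fst ℝ ℝ ℝ).smulRight c from rfl,
        ContinuousLinearMap.norm_smulRight_apply]
      exact mul_le_mul_of_nonneg_right (ContinuousLinearMap.norm_fst_le ..) (norm_nonneg _)
    have hJ₂ : ‖J₂‖ ≤ 1 := by
      refine ContinuousLinearMap.opNorm_le_bound _ zero_le_one fun c => ?_
      rw [show J₂ c = (ContinuousLinearMap.snd ℝ ℝ ℝ).smulRight c from rfl,
        ContinuousLinearMap.norm_smulRight_apply]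
      exact mul_le_mul_of_nonneg_right (ContinuousLinearMap.norm_snd_le ..) (norm_nonneg _)
    have hf : ∀ i, fderiv ℝ (T i) = (J₁ ∘ T (d₁ • i)) + (J₂ ∘ T (d₂ • i)) := fun i => by
      ext1 x
      exact (hT i x).fderiv
    have hJc : ∀ (J : ℂ →L[ℝ] (ℝ × ℝ →L[ℝ] ℂ)) i, ContDiff ℝ n (J ∘ T i) :=
      fun J i => J.contDiff.comp (hc i)
    have hJb : ∀ (J : ℂ →L[ℝ] (ℝ × ℝ →L[ℝ] ℂ)), ‖J‖ ≤ 1 → ∀ i x,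
        ‖iteratedFDeriv ℝ n (J ∘ T i) x‖ ≤ (l.map fun m => ‖T (m • i) x‖).sum := by
      intro J hJ i x
      refine (J.norm_iteratedFDeriv_comp_left (hc i).contDiffAt le_rfl).trans ?_
      exact (mul_le_of_le_one_left (norm_nonneg _) hJ).trans (hb i x)
    refine ⟨fun i => ?_, l.map (· * d₁) ++ l.map (· * d₂), ?_, fun i x => ?_⟩
    · push_cast
      refine contDiff_succ_iff_fderiv.2 ⟨fun x => (hT i x).differentiableAt, by simp, ?_⟩
      rw [hf]
      exact (hJc J₁ _).add (hJc J₂ _)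
    · intro m hm
      simp only [List.mem_append, List.mem_map] at hm
      rcases hm with ⟨a, ha, rfl⟩ | ⟨a, ha, rfl⟩
      · exact S.mul_mem (hl a ha) h₁
      · exact S.mul_mem (hl a ha) h₂
    · rw [← norm_iteratedFDeriv_fderiv, hf,
        iteratedFDeriv_add (hJc J₁ _) (hJc J₂ _)]
      refine (norm_add_le _ _).trans ?_
      simp only [List.map_append, List.map_map, List.sum_append, Function.comp_def, mul_smul]
      exact add_le_add (hJb J₁ hJ₁ _ x) (hJb J₂ hJ₂ _ x)

lemma qval_add (h₁ h₂ : MvPolynomial (Fin 2) ℂ) (x : ℝ × ℝ) :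
    qval (h₁ + h₂) x = qval h₁ x + qval h₂ x := by simp [qval]

lemma qval_sub (h₁ h₂ : MvPolynomial (Fin 2) ℂ) (x : ℝ × ℝ) :
    qval (h₁ - h₂) x = qval h₁ x - qval h₂ x := by simp [qval]

lemma qval_mul (h₁ h₂ : MvPolynomial (Fin 2) ℂ) (x : ℝ × ℝ) :
    qval (h₁ * h₂) x = qval h₁ x * qval h₂ x := by simp [qval]

@[simp] lemma qval_C (a : ℂ) (x : ℝ × ℝ) : qval (MvPolynomial.C a) x = a := by simp [qval]

@[simp] lemma qval_X_zero (x : ℝ × ℝ) : qval (MvPolynomial.X 0) x = x.1 := by simp [qval]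

@[simp] lemma qval_X_one (x : ℝ × ℝ) : qval (MvPolynomial.X 1) x = x.2 := by simp [qval]

lemma ofReal_Pval (P : MvPolynomial (Fin 2) ℝ) (x : ℝ × ℝ) :
    ((Pval P x : ℝ) : ℂ) = qval (MvPolynomial.map Complex.ofRealHom P) x := by
  simp only [Pval, qval, MvPolynomial.eval_map]
  have := MvPolynomial.eval₂_comp_left Complex.ofRealHom (RingHom.id ℝ) ![x.1, x.2] P
  rw [MvPolynomial.eval₂_id] at this
  refine this.trans ?_
  congr 1
  ext i
  fin_cases i <;> rfl

lemma hasFDerivAt_qval (h : MvPolynomial (Fin 2) ℂ) (x : ℝ × ℝ) :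
    HasFDerivAt (qval h)
      (pairCLM (qval (MvPolynomial.pderiv 0 h) x) (qval (MvPolynomial.pderiv 1 h) x)) x := by
  induction h using MvPolynomial.induction_on with
  | C a =>
    have : qval (MvPolynomial.C a) = fun _ => a := by ext; simp
    rw [this]
    convert hasFDerivAt_const a x using 1
    ext <;> simp [qval]
  | add h₁ h₂ ih₁ ih₂ =>
    have : qval (h₁ + h₂) = fun y => qval h₁ y + qval h₂ y := by ext; simp [qval_add]
    rw [this]
    refine (ih₁.add ih₂).congr_fderiv ?_
    ext <;> simp [qval_add]
  | mul_X h k ih =>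
    have hX : HasFDerivAt (qval (MvPolynomial.X k)) (pairCLM
        (qval (MvPolynomial.pderiv 0 (MvPolynomial.X k)) x)
        (qval (MvPolynomial.pderiv 1 (MvPolynomial.X k)) x)) x := by
      fin_cases k
      · have : qval (MvPolynomial.X 0) = fun y => ((y.1 : ℝ) : ℂ) := by ext; simp
        simp only [Fin.zero_eta, this]
        refine (Complex.ofRealCLM.comp
          (ContinuousLinearMap.fst ℝ ℝ ℝ)).hasFDerivAt.congr_fderiv ?_
        ext <;> simp [MvPolynomial.pderiv_X, qval]
      · have : qval (MvPolynomial.X 1) = fun y => ((y.2 : ℝ) : ℂ) := by ext; simp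
        simp only [Fin.mk_one, this]
        refine (Complex.ofRealCLM.comp
          (ContinuousLinearMap.snd ℝ ℝ ℝ)).hasFDerivAt.congr_fderiv ?_
        ext <;> simp [MvPolynomial.pderiv_X, qval]
    have : qval (h * MvPolynomial.X k) = fun y => qval h y * qval (MvPolynomial.X k) y := by
      ext; simp [qval_mul]
    rw [this]
    refine (ih.mul hX).congr_fderiv ?_
    ext <;> simp [Derivation.leibniz, qval_mul, qval_add]

lemma exists_norm_qval_le (h : MvPolynomial (Fin 2) ℂ) :
    ∃ (C : ℝ) (N : ℕ), 0 ≤ C ∧ ∀ x, ‖qval h x‖ ≤ C * (1 + ‖x‖) ^ N := by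
  induction h using MvPolynomial.induction_on with
  | C a => exact ⟨‖a‖, 0, norm_nonneg _, by simp⟩
  | add h₁ h₂ ih₁ ih₂ =>
    obtain ⟨C₁, N₁, hC₁, hb₁⟩ := ih₁
    obtain ⟨C₂, N₂, hC₂, hb₂⟩ := ih₂
    refine ⟨C₁ + C₂, max N₁ N₂, by positivity, fun x => ?_⟩
    have h1 : 1 ≤ 1 + ‖x‖ := by simp
    rw [qval_add, add_mul]
    refine (norm_add_le _ _).trans (add_le_add ((hb₁ x).trans ?_) ((hb₂ x).trans ?_))
    · gcongr
      exact le_max_left _ _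
    · gcongr
      exact le_max_right _ _
  | mul_X h k ih =>
    obtain ⟨C, N, hC, hb⟩ := ih
    refine ⟨C, N + 1, hC, fun x => ?_⟩
    rw [qval_mul, norm_mul, pow_succ, ← mul_assoc]
    have hX : ‖qval (MvPolynomial.X k) x‖ ≤ 1 + ‖x‖ := by
      fin_cases k
      · simpa using (norm_fst_le x).trans (le_add_of_nonneg_left zero_le_one)
      · simpa using (norm_snd_le x).trans (le_add_of_nonneg_left zero_le_one)
    exact mul_le_mul (hb x) hX (norm_nonneg _) (by positivity)

/-- The function `h e^{-iP} q^{-j}` for polynomials `h`, `P`, `q`. -/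
def oscQuot (P : MvPolynomial (Fin 2) ℝ) (q : MvPolynomial (Fin 2) ℂ)
    (i : MvPolynomial (Fin 2) ℂ × ℕ) : Fn2 :=
  fun x => qval i.1 x * Complex.exp (-Complex.I * ((Pval P x : ℝ) : ℂ)) * (qval q x)⁻¹ ^ i.2

/-- The index of the partial derivative `∂ₖ` of `oscQuot P q i`. -/
def oscQuotDeriv (P : MvPolynomial (Fin 2) ℝ) (q : MvPolynomial (Fin 2) ℂ) (k : Fin 2) :
    Function.End (MvPolynomial (Fin 2) ℂ × ℕ) :=
  fun i => (q * (MvPolynomial.pderiv k i.1 - MvPolynomial.C Complex.I * i.1 *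
      MvPolynomial.pderiv k (MvPolynomial.map Complex.ofRealHom P)) -
    MvPolynomial.C (i.2 : ℂ) * i.1 * MvPolynomial.pderiv k q, i.2 + 1)

lemma hasFDerivAt_oscQuot (P : MvPolynomial (Fin 2) ℝ) {q : MvPolynomial (Fin 2) ℂ}
    (hq : ∀ ξ : ℝ × ℝ, qval q ξ ≠ 0) (i : MvPolynomial (Fin 2) ℂ × ℕ) (x : ℝ × ℝ) :
    HasFDerivAt (oscQuot P q i) (pairCLM (oscQuot P q (oscQuotDeriv P q 0 • i) x)
      (oscQuot P q (oscQuotDeriv P q 1 • i) x)) x := by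
  obtain ⟨h, j⟩ := i
  have he := ((hasFDerivAt_qval (MvPolynomial.map Complex.ofRealHom P) x).const_mul
    (-Complex.I)).cexp
  simp only [← ofReal_Pval] at he
  have hj := ((hasFDerivAt_inv' (𝕜 := ℝ) (hq x)).comp x (hasFDerivAt_qval q x)).pow j
  have := ((hasFDerivAt_qval h x).mul he).mul hj
  refine this.congr_fderiv ?_
  have key : ∀ a b c : ℂ, ∀ k, a = qval (MvPolynomial.pderiv k h) x →
      b = qval (MvPolynomial.pderiv k (MvPolynomial.map Complex.ofRealHom P)) x →
      c = qval (MvPolynomial.pderiv k q) x →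
      qval h x * Complex.exp (-Complex.I * (Pval P x : ℂ)) *
        ((j : ℂ) * (qval q x)⁻¹ ^ (j - 1) * -((qval q x ^ 2)⁻¹ * c)) +
      (qval q x)⁻¹ ^ j * (qval h x * (Complex.exp (-Complex.I * (Pval P x : ℂ)) *
        (-Complex.I * b)) + Complex.exp (-Complex.I * (Pval P x : ℂ)) * a) =
      oscQuot P q (oscQuotDeriv P q k • (h, j)) x := by
    rintro a b c k rfl rfl rfl
    have h0 := hq x
    simp only [oscQuot, oscQuotDeriv, Function.End.smul_def, qval_sub, qval_mul, qval_C]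
    rcases j with _ | j
    · simp
      field_simp
      ring
    · simp only [Nat.add_sub_cancel, inv_pow]
      field_simp
      ring
  ext
  · rw [ContinuousLinearMap.comp_apply, ContinuousLinearMap.comp_apply, pairCLM_apply]
    simp only [← key _ _ _ 0 rfl rfl rfl]
    simp
    ring
  · rw [ContinuousLinearMap.comp_apply, ContinuousLinearMap.comp_apply, pairCLM_apply]
    simp only [← key _ _ _ 1 rfl rfl rfl]
    simp
    ring

lemma exists_norm_oscQuot_le (P : MvPolynomial (Fin 2) ℝ) {q : MvPolynomial (Fin 2) ℂ}
    (hL : ∃ (C : ℝ) (N : ℕ), 0 ≤ C ∧ ∀ x, ‖(qval q x)⁻¹‖ ≤ C * (1 + ‖x‖) ^ N)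
    (i : MvPolynomial (Fin 2) ℂ × ℕ) :
    ∃ (C : ℝ) (N : ℕ), 0 ≤ C ∧ ∀ x, ‖oscQuot P q i x‖ ≤ C * (1 + ‖x‖) ^ N := by
  obtain ⟨C₁, N₁, hC₁, hb₁⟩ := exists_norm_qval_le i.1
  obtain ⟨C₂, N₂, hC₂, hb₂⟩ := hL
  refine ⟨C₁ * C₂ ^ i.2, N₁ + N₂ * i.2, by positivity, fun x => ?_⟩
  have he : ‖Complex.exp (-Complex.I * ((Pval P x : ℝ) : ℂ))‖ = 1 := by
    rw [Complex.norm_exp]; simp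
  rw [oscQuot, norm_mul, norm_mul, he, mul_one, norm_pow]
  calc _ ≤ (C₁ * (1 + ‖x‖) ^ N₁) * (C₂ * (1 + ‖x‖) ^ N₂) ^ i.2 := by
        gcongr
        exacts [hb₁ x, hb₂ x]
    _ = _ := by ring

lemma hasTemperateGrowth_oscQuot (P : MvPolynomial (Fin 2) ℝ) {q : MvPolynomial (Fin 2) ℂ}
    (hq : ∀ ξ : ℝ × ℝ, qval q ξ ≠ 0)
    (hL : ∃ (C : ℝ) (N : ℕ), 0 ≤ C ∧ ∀ x, ‖(qval q x)⁻¹‖ ≤ C * (1 + ‖x‖) ^ N)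
    (i : MvPolynomial (Fin 2) ℂ × ℕ) : (oscQuot P q i).HasTemperateGrowth := by
  have key := contDiff_and_norm_iteratedFDeriv_le (⊤ : Submonoid (Function.End _)) trivial trivial
    (oscQuot P q) (hasFDerivAt_oscQuot P hq)
  refine ⟨contDiff_infty.2 fun n => (key n).1 i, fun n => ?_⟩
  obtain ⟨-, l, -, hl⟩ := key n
  have hsum : ∃ (N : ℕ) (C : ℝ), ∀ x,
      (l.map fun m => ‖oscQuot P q (m • i) x‖).sum ≤ C * (1 + ‖x‖) ^ N := by
    clear hl
    induction l with
    | nil => exact ⟨0, 0, by simp⟩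
    | cons m l ih =>
      obtain ⟨N, C, hC⟩ := ih
      obtain ⟨C', N', hC'0, hC'⟩ := exists_norm_oscQuot_le P hL (m • i)
      refine ⟨max N N', |C| + C', fun x => ?_⟩
      have h1 : 1 ≤ 1 + ‖x‖ := by simp
      rw [List.map_cons, List.sum_cons, add_comm, add_mul]
      refine add_le_add ((hC x).trans ?_) ((hC' x).trans ?_)
      · gcongr
        exacts [le_abs_self C, le_max_left _ _]
      · gcongr
        exact le_max_right _ _
  obtain ⟨N, C, hC⟩ := hsum
  exact ⟨N, C, fun x => (hl i x).trans (hC x)⟩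

open Polynomial in
lemma evalEval_comp_right (R p : ℝ[X][X]) (x y : ℝ) :
    (R.comp p).evalEval x y = R.evalEval x (p.evalEval x y) := by
  have h := Polynomial.hom_eval₂ R (Polynomial.C : ℝ[X] →+* ℝ[X][X]) (evalEvalRingHom x y) p
  have h' := congrFun (congrFun (eval₂_evalRingHom x) (p.evalEval x y)) R
  rw [Polynomial.comp, ← h']
  refine h.trans ?_
  congr 1
  ext <;> simp

open Polynomial in
/-- The critical values of `y ↦ p(x, y)` are roots of a nonzero polynomial over `ℝ[x]`. -/
lemma exists_evalEval_eq_zero_of_critical (p : ℝ[X][X]) :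
    ∃ R : ℝ[X][X], R ≠ 0 ∧ ∀ x y, (derivative p).evalEval x y = 0 →
      R.evalEval x (p.evalEval x y) = 0 := by
  by_cases hD : derivative p = 0
  · refine ⟨X - C (p.coeff 0), X_sub_C_ne_zero _, fun x y _ => ?_⟩
    have hp : p = C (p.coeff 0) := eq_C_of_natDegree_eq_zero (derivative_eq_zero.1 hD)
    rw [hp]
    simp [evalEval]
  let K := FractionRing ℝ[X]
  have hι : Function.Injective (algebraMap ℝ[X] K) := IsFractionRing.injective ℝ[X] K
  have hDK : (derivative p).map (algebraMap ℝ[X] K) ≠ 0 := (Polynomial.map_ne_zero_iff hι).2 hD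
  have : Module.Finite K (AdjoinRoot ((derivative p).map (algebraMap ℝ[X] K))) :=
    (AdjoinRoot.powerBasis hDK).finite
  obtain ⟨r, hr, hr0⟩ := IsIntegral.of_finite K
    (AdjoinRoot.mk ((derivative p).map (algebraMap ℝ[X] K)) (p.map (algebraMap ℝ[X] K)))
  have hdvd : (derivative p).map (algebraMap ℝ[X] K) ∣ r.comp (p.map (algebraMap ℝ[X] K)) := by
    rw [← AdjoinRoot.mk_eq_zero, Polynomial.comp, Polynomial.hom_eval₂]
    exact hr0
  obtain ⟨s, hs⟩ := hdvd
  obtain ⟨b, hb, hR⟩ := IsLocalization.integerNormalization_spec (nonZeroDivisors ℝ[X]) r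
  obtain ⟨b', hb', hS⟩ := IsLocalization.integerNormalization_spec (nonZeroDivisors ℝ[X]) s
  set R := IsLocalization.integerNormalization (nonZeroDivisors ℝ[X]) r with hRdef
  set S := IsLocalization.integerNormalization (nonZeroDivisors ℝ[X]) s
  have hsm : ∀ (b : ℝ[X]) (f : K[X]), b • f = C (algebraMap ℝ[X] K b) * f := fun b f => by
    rw [Algebra.smul_def]; rfl
  rw [hsm] at hR hS
  have key : C b' * R.comp p = derivative p * (C b * S) := by
    refine Polynomial.map_injective _ hι ?_
    simp only [Polynomial.map_mul, Polynomial.map_comp, Polynomial.map_C, hR, hS,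
      Polynomial.mul_comp, Polynomial.C_comp, hs]
    ring
  have hR0 : R ≠ 0 := fun h =>
    hr.ne_zero ((IsLocalization.integerNormalization_eq_zero_iff le_rfl r).1 h)
  refine ⟨C b' * R, mul_ne_zero (C_ne_zero.2 (nonZeroDivisors.ne_zero hb')) hR0,
    fun x y hxy => ?_⟩
  rw [← evalEval_comp_right, Polynomial.mul_comp, Polynomial.C_comp, key, evalEval_mul, hxy,
    zero_mul]

open Polynomial in
lemma exists_forall_eval_le_of_pos (g : ℝ[X]) (hg : ∀ y, 0 < g.eval y) :
    ∃ y₀, (derivative g).eval y₀ = 0 ∧ ∀ y, g.eval y₀ ≤ g.eval y := by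
  have hmin : ∃ y₀, ∀ y, g.eval y₀ ≤ g.eval y := by
    rcases le_or_gt g.degree 0 with h | h
    · rw [eq_C_of_degree_le_zero h]
      simp
    · have ht : Filter.Tendsto (fun y => g.eval y) (Filter.cocompact ℝ) Filter.atTop := by
        refine (g.tendsto_norm_atTop h tendsto_norm_cocompact_atTop).congr fun y => ?_
        exact Real.norm_of_nonneg (hg y).le
      exact g.continuous.exists_forall_le ht
  obtain ⟨y₀, hy₀⟩ := hmin
  refine ⟨y₀, ?_, hy₀⟩
  have : IsLocalMin (fun y => g.eval y) y₀ := Filter.Eventually.of_forall hy₀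
  simpa using this.hasDerivAt_eq_zero (g.hasDerivAt y₀)

open Polynomial in
lemma exists_abs_eval_le (a : ℝ[X]) :
    ∃ (C : ℝ) (N : ℕ), 0 ≤ C ∧ ∀ x, |a.eval x| ≤ C * (1 + |x|) ^ N := by
  induction a using Polynomial.induction_on' with
  | add a b iha ihb =>
    obtain ⟨C₁, N₁, hC₁, hb₁⟩ := iha
    obtain ⟨C₂, N₂, hC₂, hb₂⟩ := ihb
    refine ⟨C₁ + C₂, max N₁ N₂, by positivity, fun x => ?_⟩
    have h1 : 1 ≤ 1 + |x| := by simp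
    rw [eval_add, add_mul]
    refine (abs_add_le _ _).trans (add_le_add ((hb₁ x).trans ?_) ((hb₂ x).trans ?_))
    · gcongr
      exact le_max_left _ _
    · gcongr
      exact le_max_right _ _
  | monomial n a =>
    refine ⟨|a|, n, abs_nonneg _, fun x => ?_⟩
    rw [eval_monomial, abs_mul, abs_pow]
    gcongr
    simp

open Polynomial in
lemma exists_abs_evalEval_le (R : ℝ[X][X]) :
    ∃ (C : ℝ) (N : ℕ), 0 ≤ C ∧ ∀ x z, |z| ≤ 1 → |R.evalEval x z| ≤ C * (1 + |x|) ^ N := by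
  induction R using Polynomial.induction_on' with
  | add a b iha ihb =>
    obtain ⟨C₁, N₁, hC₁, hb₁⟩ := iha
    obtain ⟨C₂, N₂, hC₂, hb₂⟩ := ihb
    refine ⟨C₁ + C₂, max N₁ N₂, by positivity, fun x z hz => ?_⟩
    have h1 : 1 ≤ 1 + |x| := by simp
    rw [evalEval_add, add_mul]
    refine (abs_add_le _ _).trans (add_le_add ((hb₁ x z hz).trans ?_) ((hb₂ x z hz).trans ?_))
    · gcongr
      exact le_max_left _ _
    · gcongr
      exact le_max_right _ _
  | monomial n a =>
    obtain ⟨C, N, hC, hb⟩ := exists_abs_eval_le a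
    refine ⟨C, N, hC, fun x z hz => ?_⟩
    have : (monomial n a).evalEval x z = a.eval x * z ^ n := by simp [evalEval]
    rw [this, abs_mul, abs_pow]
    exact (mul_le_of_le_one_right (abs_nonneg _) (pow_le_one₀ (abs_nonneg _) hz)).trans (hb x)

open Polynomial in
lemma exists_le_abs_eval (a : ℝ[X]) (ha : a ≠ 0) :
    ∃ c X₀ : ℝ, 0 < c ∧ ∀ x, X₀ ≤ |x| → c ≤ |a.eval x| := by
  rcases le_or_gt a.degree 0 with h | h
  · rw [eq_C_of_degree_le_zero h] at ha ⊢
    exact ⟨|a.coeff 0|, 0, abs_pos.2 (by simpa using ha), by simp⟩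
  · have ht := a.tendsto_norm_atTop h (tendsto_norm_cocompact_atTop (E := ℝ))
    have := ht.eventually_ge_atTop 1
    rw [← Metric.cobounded_eq_cocompact, ← comap_norm_atTop, Filter.eventually_comap, Filter.eventually_atTop] at this
    obtain ⟨X₀, hX₀⟩ := this
    exact ⟨1, X₀, one_pos, fun x hx => hX₀ _ hx x rfl⟩

open Polynomial in
/-- A positive polynomial in two variables decays at most polynomially in `x`, uniformly in
`y`, for large `x`. -/
lemma exists_le_evalEval_of_pos (p : ℝ[X][X]) (hp : ∀ x y, 0 < p.evalEval x y) :
    ∃ (c X₀ : ℝ) (N : ℕ), 0 < c ∧ ∀ x y, X₀ ≤ |x| → c ≤ (1 + |x|) ^ N * p.evalEval x y := by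
  obtain ⟨R, hR0, hR⟩ := exists_evalEval_eq_zero_of_critical p
  obtain ⟨R₁, hR₁, hdvd⟩ := exists_eq_pow_rootMultiplicity_mul_and_not_dvd R hR0 0
  rw [C_0, sub_zero] at hR₁ hdvd
  set k := rootMultiplicity 0 R
  rw [X_dvd_iff] at hdvd
  obtain ⟨c, X₀, hc, ha⟩ := exists_le_abs_eval _ hdvd
  obtain ⟨B, N, hB, hb⟩ := exists_abs_evalEval_le R₁.divX
  refine ⟨min 1 (c / (B + 1)), X₀, N, by positivity, fun x y hx => ?_⟩
  have hev : ∀ y, (p.map (evalRingHom x)).eval y = p.evalEval x y := fun y => by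
    rw [eval_map, eval₂_evalRingHom]
  obtain ⟨y₀, hy₀, hmin⟩ := exists_forall_eval_le_of_pos (p.map (evalRingHom x))
    fun y => by rw [hev]; exact hp x y
  rw [derivative_map, eval_map, eval₂_evalRingHom] at hy₀
  simp only [hev] at hmin
  set m := p.evalEval x y₀ with hm
  have hm0 : 0 < m := hp x y₀
  have h1 : 1 ≤ (1 + |x|) ^ N := one_le_pow₀ (by simp)
  have hroot : R₁.evalEval x m = 0 := by
    have := hR x y₀ hy₀
    rw [hR₁, evalEval_mul, evalEval_pow, evalEval_X] at this
    exact (mul_eq_zero.1 this).resolve_left (pow_ne_zero _ hm0.ne')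
  have hmle : min 1 (c / (B + 1)) ≤ (1 + |x|) ^ N * m := by
    rcases le_or_gt 1 m with h | h
    · exact (min_le_left _ _).trans (one_le_mul_of_one_le_of_one_le h1 h)
    · refine (min_le_right _ _).trans ?_
      rw [← divX_mul_X_add R₁, evalEval_add, evalEval_mul, evalEval_X, evalEval_C] at hroot
      have h2 := ha x hx
      rw [eq_neg_of_add_eq_zero_right hroot, abs_neg, abs_mul, abs_of_pos hm0] at h2
      have h3 := hb x m (by rw [abs_of_pos hm0]; exact h.le)
      rw [div_le_iff₀ (by positivity)]
      calc c ≤ _ := h2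
        _ ≤ (B * (1 + |x|) ^ N) * m := by gcongr
        _ ≤ ((B + 1) * (1 + |x|) ^ N) * m := by gcongr; linarith
        _ = _ := by ring
  exact hmle.trans (by gcongr; exact hmin y)

open Polynomial in
lemma exists_qval_eq_evalEval (q : MvPolynomial (Fin 2) ℂ) :
    ∃ a b : ℝ[X][X], ∀ x y : ℝ, qval q (x, y) = ⟨a.evalEval x y, b.evalEval x y⟩ := by
  induction q using MvPolynomial.induction_on with
  | C z => exact ⟨C (C z.re), C (C z.im), fun x y => by simp⟩
  | add h₁ h₂ ih₁ ih₂ =>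
    obtain ⟨a₁, b₁, h₁⟩ := ih₁
    obtain ⟨a₂, b₂, h₂⟩ := ih₂
    exact ⟨a₁ + a₂, b₁ + b₂, fun x y => by
      rw [qval_add, h₁, h₂]; apply Complex.ext <;> simp [evalEval_add]⟩
  | mul_X h k ih =>
    obtain ⟨a, b, h⟩ := ih
    fin_cases k
    · exact ⟨a * C X, b * C X, fun x y => by
        rw [qval_mul, h]; apply Complex.ext <;> simp [evalEval_mul, evalEval_C]⟩
    · exact ⟨a * X, b * X, fun x y => by
        rw [qval_mul, h]; apply Complex.ext <;> simp [evalEval_mul]⟩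

lemma exists_le_normSq_qval {q : MvPolynomial (Fin 2) ℂ} (hq : ∀ ξ : ℝ × ℝ, qval q ξ ≠ 0) :
    ∃ (c X₀ : ℝ) (N : ℕ), 0 < c ∧
      ∀ x y : ℝ, X₀ ≤ |x| → c ≤ (1 + |x|) ^ N * Complex.normSq (qval q (x, y)) := by
  obtain ⟨a, b, hab⟩ := exists_qval_eq_evalEval q
  have hp : ∀ x y, (a * a + b * b).evalEval x y = Complex.normSq (qval q (x, y)) := fun x y => by
    rw [hab, Complex.normSq_mk, Polynomial.evalEval_add, Polynomial.evalEval_mul,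
      Polynomial.evalEval_mul]
  simpa only [hp] using exists_le_evalEval_of_pos (a * a + b * b)
    fun x y => by rw [hp]; exact Complex.normSq_pos.2 (hq _)

/-- The reciprocal of a nowhere vanishing polynomial on `ℝ²` grows at most polynomially. -/
theorem exists_norm_inv_qval_le {q : MvPolynomial (Fin 2) ℂ} (hq : ∀ ξ : ℝ × ℝ, qval q ξ ≠ 0) :
    ∃ (C : ℝ) (N : ℕ), 0 ≤ C ∧ ∀ x, ‖(qval q x)⁻¹‖ ≤ C * (1 + ‖x‖) ^ N := by
  have hswap : ∀ ξ : ℝ × ℝ, qval (MvPolynomial.rename (Equiv.swap (0 : Fin 2) 1) q) ξ =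
      qval q ξ.swap := fun ξ => by
    have h : ![(ξ.1 : ℂ), (ξ.2 : ℂ)] ∘ ⇑(Equiv.swap (0 : Fin 2) 1) = ![(ξ.2 : ℂ), (ξ.1 : ℂ)] := by
      funext i
      fin_cases i <;> simp
    rw [qval, MvPolynomial.eval_rename, h]
    rfl
  obtain ⟨c₁, X₁, N₁, hc₁, h₁⟩ := exists_le_normSq_qval hq
  obtain ⟨c₂, X₂, N₂, hc₂, h₂⟩ := exists_le_normSq_qval
    (q := MvPolynomial.rename (Equiv.swap (0 : Fin 2) 1) q) fun ξ => by rw [hswap]; exact hq _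
  simp only [hswap, Prod.swap_prod_mk] at h₂
  have hcont : Continuous (qval q) :=
    continuous_iff_continuousAt.2 fun x => (hasFDerivAt_qval q x).continuousAt
  obtain ⟨c₃, hc₃, h₃⟩ : ∃ c₃ > 0, ∀ x ∈ Metric.closedBall (0 : ℝ × ℝ) (max X₁ X₂),
      c₃ ≤ Complex.normSq (qval q x) :=
    (isCompact_closedBall _ _).exists_forall_le' (Complex.continuous_normSq.comp hcont).continuousOn
      fun x _ => Complex.normSq_pos.2 (hq x)
  obtain ⟨c, hc, N, hcN⟩ : ∃ c > 0, ∃ N : ℕ, ∀ x,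
      c ≤ (1 + ‖x‖) ^ N * Complex.normSq (qval q x) := by
    refine ⟨min c₁ (min c₂ c₃), by positivity, max N₁ N₂, fun x => ?_⟩
    have hx1 : 1 ≤ 1 + ‖x‖ := by simp
    have hn := Complex.normSq_nonneg (qval q x)
    by_cases hx₁ : X₁ ≤ |x.1|
    · refine (min_le_left _ _).trans ((h₁ x.1 x.2 hx₁).trans ?_)
      gcongr
      calc (1 + |x.1|) ^ N₁ ≤ (1 + ‖x‖) ^ N₁ := by gcongr; exact norm_fst_le x
        _ ≤ _ := by gcongr; exact le_max_left _ _
    by_cases hx₂ : X₂ ≤ |x.2|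
    · refine ((min_le_right _ _).trans (min_le_left _ _)).trans ((h₂ x.2 x.1 hx₂).trans ?_)
      gcongr
      calc (1 + |x.2|) ^ N₂ ≤ (1 + ‖x‖) ^ N₂ := by gcongr; exact norm_snd_le x
        _ ≤ _ := by gcongr; exact le_max_right _ _
    · refine ((min_le_right _ _).trans (min_le_right _ _)).trans ((h₃ x ?_).trans ?_)
      · rw [mem_closedBall_zero_iff, Prod.norm_def]
        exact max_le_max (not_le.1 hx₁).le (not_le.1 hx₂).le
      · exact le_mul_of_one_le_left hn (one_le_pow₀ hx1)
  refine ⟨1 + c⁻¹, N, by positivity, fun x => ?_⟩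
  have hx1 : 1 ≤ (1 + ‖x‖) ^ N := one_le_pow₀ (by simp)
  have hq0 : 0 < ‖qval q x‖ := norm_pos_iff.2 (hq x)
  have h := hcN x
  rw [Complex.normSq_eq_norm_sq] at h
  have h' : ‖(qval q x)⁻¹‖ ^ 2 ≤ c⁻¹ * (1 + ‖x‖) ^ N := by
    rw [norm_inv, inv_pow, inv_le_iff_one_le_mul₀ (by positivity)]
    field_simp
    linarith
  nlinarith [sq_nonneg (‖(qval q x)⁻¹‖ - 1), norm_nonneg (qval q x)⁻¹]

/-- Schwartz-type bounds for a family of functions on `ℝ²` closed under partial derivatives and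
under multiplication by the coordinates. -/
theorem norm_pow_mul_norm_iteratedFDeriv_le {M ι : Type*} [Monoid M] [MulAction M ι]
    (S : Submonoid M) {d₁ d₂ y₁ y₂ : M} (hd₁ : d₁ ∈ S) (hd₂ : d₂ ∈ S) (hy₁ : y₁ ∈ S)
    (hy₂ : y₂ ∈ S) (T : ι → Fn2)
    (hT : ∀ i x, HasFDerivAt (T i) (pairCLM (T (d₁ • i) x) (T (d₂ • i) x)) x)
    (hT₁ : ∀ i x, T (y₁ • i) x = x.1 * T i x) (hT₂ : ∀ i x, T (y₂ • i) x = x.2 * T i x)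
    (p : ι → ℝ) (hp : ∀ i x, ‖T i x‖ ≤ p i) (k n : ℕ) :
    ∃ l : List M, (∀ m ∈ l, m ∈ S) ∧ ∀ i x,
      ‖x‖ ^ k * ‖iteratedFDeriv ℝ n (T i) x‖ ≤ (l.map fun m => p (m • i)).sum := by
  obtain ⟨-, l, hl, hb⟩ := contDiff_and_norm_iteratedFDeriv_le S hd₁ hd₂ T hT n
  have hpow₁ : ∀ i x, T (y₁ ^ k • i) x = (x.1 : ℂ) ^ k * T i x := by
    induction k with
    | zero => simp
    | succ k ih => intro i x; rw [pow_succ', mul_smul, hT₁, ih]; ring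
  have hpow₂ : ∀ i x, T (y₂ ^ k • i) x = (x.2 : ℂ) ^ k * T i x := by
    clear hpow₁
    induction k with
    | zero => simp
    | succ k ih => intro i x; rw [pow_succ', mul_smul, hT₂, ih]; ring
  have key : ∀ i x, ‖x‖ ^ k * ‖T i x‖ ≤ p (y₁ ^ k • i) + p (y₂ ^ k • i) := fun i x => by
    have h₁ := hp (y₁ ^ k • i) x
    have h₂ := hp (y₂ ^ k • i) x
    rw [hpow₁, norm_mul, norm_pow, Complex.norm_real] at h₁
    rw [hpow₂, norm_mul, norm_pow, Complex.norm_real] at h₂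
    rcases max_choice ‖x.1‖ ‖x.2‖ with h | h <;> rw [Prod.norm_def, h]
    · exact h₁.trans (le_add_of_nonneg_right ((norm_nonneg _).trans (hp _ x)))
    · exact h₂.trans (le_add_of_nonneg_left ((norm_nonneg _).trans (hp _ x)))
  refine ⟨l.map (y₁ ^ k * ·) ++ l.map (y₂ ^ k * ·), ?_, fun i x => ?_⟩
  · intro m hm
    simp only [List.mem_append, List.mem_map] at hm
    rcases hm with ⟨a, ha, rfl⟩ | ⟨a, ha, rfl⟩
    · exact S.mul_mem (S.pow_mem hy₁ k) (hl a ha)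
    · exact S.mul_mem (S.pow_mem hy₂ k) (hl a ha)
  · refine (mul_le_mul_of_nonneg_left (hb i x) (by positivity)).trans ?_
    rw [← List.sum_map_mul_left]
    simp only [List.map_append, List.map_map, List.sum_append, Function.comp_def, mul_smul]
    rw [← List.sum_map_add]
    exact List.sum_le_sum fun m _ => key _ _

/-- The Schwartz space on `ℝ²`. -/
abbrev S2 := 𝓢(ℝ × ℝ, ℂ)

/-- The algebra of continuous operators on the Schwartz space. -/
abbrev End2 := S2 →L[ℂ] S2

/-- Multiplication by the first coordinate. -/
def mulX₁ : End2 := smulLeftCLM ℂ fun x : ℝ × ℝ => (x.1 : ℂ)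

/-- Multiplication by the second coordinate. -/
def mulX₂ : End2 := smulLeftCLM ℂ fun x : ℝ × ℝ => (x.2 : ℂ)

/-- Differentiation in the first coordinate. -/
def der₁ : End2 := LineDeriv.lineDerivOpCLM ℂ S2 ((1, 0) : ℝ × ℝ)

/-- Differentiation in the second coordinate. -/
def der₂ : End2 := LineDeriv.lineDerivOpCLM ℂ S2 ((0, 1) : ℝ × ℝ)

lemma hasTemperateGrowth_ofReal_fst :
    Function.HasTemperateGrowth fun x : ℝ × ℝ => (x.1 : ℂ) :=
  (Complex.ofRealCLM.comp (ContinuousLinearMap.fst ℝ ℝ ℝ)).hasTemperateGrowth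

lemma hasTemperateGrowth_ofReal_snd :
    Function.HasTemperateGrowth fun x : ℝ × ℝ => (x.2 : ℂ) :=
  (Complex.ofRealCLM.comp (ContinuousLinearMap.snd ℝ ℝ ℝ)).hasTemperateGrowth

@[simp] lemma mulX₁_apply (f : S2) (x : ℝ × ℝ) : mulX₁ f x = x.1 * f x :=
  smulLeftCLM_apply_apply hasTemperateGrowth_ofReal_fst f x

@[simp] lemma mulX₂_apply (f : S2) (x : ℝ × ℝ) : mulX₂ f x = x.2 * f x :=
  smulLeftCLM_apply_apply hasTemperateGrowth_ofReal_snd f x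

lemma hasFDerivAt_schwartz (f : S2) (x : ℝ × ℝ) :
    HasFDerivAt f (pairCLM (der₁ f x) (der₂ f x)) x := by
  refine (f.hasFDerivAt x).congr_fderiv (ContinuousLinearMap.ext fun v => ?_)
  have hv : v = v.1 • ((1, 0) : ℝ × ℝ) + v.2 • ((0, 1) : ℝ × ℝ) := by ext <;> simp
  have h₁ : der₁ f x = fderiv ℝ f x (1, 0) := lineDerivOp_apply_eq_fderiv _ f x
  have h₂ : der₂ f x = fderiv ℝ f x (0, 1) := lineDerivOp_apply_eq_fderiv _ f x
  conv_lhs => rw [hv, map_add, map_smul, map_smul]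
  rw [pairCLM_apply, h₁, h₂, real_smul, real_smul]

/-- `B` is the transpose of `A` for the bilinear pairing `∫ f φ`. -/
def IsTranspose (A B : End2) : Prop :=
  ∀ f φ : S2, ∫ x, A f x * φ x = ∫ x, f x * B φ x

lemma IsTranspose.symm {A B : End2} (h : IsTranspose A B) : IsTranspose B A := fun f φ => by
  simpa only [mul_comm] using (h φ f).symm

lemma IsTranspose.one : IsTranspose 1 1 := fun _ _ => rfl

lemma IsTranspose.mul {A B A' B' : End2} (h : IsTranspose A B) (h' : IsTranspose A' B') :
    IsTranspose (A * A') (B' * B) := fun f φ => (h (A' f) φ).trans (h' f (B φ))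

lemma integrable_mul_schwartz (f φ : S2) : Integrable fun x => f x * φ x :=
  (pairing (ContinuousLinearMap.mul ℂ ℂ) f φ).integrable (μ := volume)

lemma IsTranspose.add {A B A' B' : End2} (h : IsTranspose A B) (h' : IsTranspose A' B') :
    IsTranspose (A + A') (B + B') := fun f φ => by
  have h₁ : ∀ x, (A + A') f x * φ x = A f x * φ x + A' f x * φ x := fun x => add_mul ..
  have h₂ : ∀ x, f x * (B + B') φ x = f x * B φ x + f x * B' φ x := fun x => mul_add ..
  simp only [h₁, h₂]
  rw [integral_add (integrable_mul_schwartz _ _) (integrable_mul_schwartz _ _),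
    integral_add (integrable_mul_schwartz _ _) (integrable_mul_schwartz _ _), h, h']

lemma IsTranspose.smul {A B : End2} (h : IsTranspose A B) (c : ℂ) :
    IsTranspose (c • A) (c • B) := fun f φ => by
  have h₁ : ∀ x, (c • A) f x * φ x = c * (A f x * φ x) := fun x => mul_assoc ..
  have h₂ : ∀ x, f x * (c • B) φ x = c * (f x * B φ x) := fun x => mul_left_comm ..
  simp only [h₁, h₂]
  rw [integral_const_mul, integral_const_mul, h]

lemma isTranspose_smulLeftCLM {m : Fn2} (hm : m.HasTemperateGrowth) :
    IsTranspose (smulLeftCLM ℂ m) (smulLeftCLM ℂ m) := fun f φ => by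
  simp only [smulLeftCLM_apply_apply hm, smul_eq_mul]
  exact integral_congr_ae (.of_forall fun x => by ring)

lemma isTranspose_lineDeriv (v : ℝ × ℝ) :
    IsTranspose (LineDeriv.lineDerivOpCLM ℂ S2 v) (-LineDeriv.lineDerivOpCLM ℂ S2 v) :=
  fun f φ => by
  have h := integral_mul_lineDerivOp_right_eq_neg_left f φ v (μ := volume)
  have h₁ : ∀ x, f x * (-LineDeriv.lineDerivOpCLM ℂ S2 v) φ x =
      -(f x * (LineDeriv.lineDerivOp v φ) x) := fun x => mul_neg ..
  simp only [h₁]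
  rw [integral_neg, h, neg_neg]
  rfl

/-- Composition with a linear automorphism of `ℝ²`. -/
def compLin (L : (ℝ × ℝ) ≃L[ℝ] ℝ × ℝ) : End2 := compCLMOfContinuousLinearEquiv ℂ L

@[simp] lemma compLin_apply (L : (ℝ × ℝ) ≃L[ℝ] ℝ × ℝ) (f : S2) (x : ℝ × ℝ) :
    compLin L f x = f (L x) := rfl

lemma isUnit_compLin (L : (ℝ × ℝ) ≃L[ℝ] ℝ × ℝ) : IsUnit (compLin L) :=
  ⟨⟨compLin L, compLin L.symm, by ext; simp, by ext; simp⟩, rfl⟩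

lemma exists_isTranspose_compLin (L : (ℝ × ℝ) ≃L[ℝ] ℝ × ℝ) :
    ∃ B, IsUnit B ∧ IsTranspose (compLin L) B := by
  have hdet : LinearMap.det (L : ℝ × ℝ →ₗ[ℝ] ℝ × ℝ) ≠ 0 :=
    (LinearEquiv.isUnit_det' L.toLinearEquiv).ne_zero
  have hc : 0 < |(LinearMap.det (L : ℝ × ℝ →ₗ[ℝ] ℝ × ℝ))⁻¹| := abs_pos.2 (inv_ne_zero hdet)
  set c := |(LinearMap.det (L : ℝ × ℝ →ₗ[ℝ] ℝ × ℝ))⁻¹|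
  have hc' : (c : ℂ) ≠ 0 := by exact_mod_cast hc.ne'
  refine ⟨(c : ℂ) • compLin L.symm, (isUnit_compLin L.symm).smul (Units.mk0 _ hc'), fun f φ => ?_⟩
  have hmap := Measure.map_linearMap_addHaar_eq_smul_addHaar (volume : Measure (ℝ × ℝ)) hdet
  have hcv : ∀ h : Fn2, ∫ x, h (L x) = c * ∫ x, h x := fun h => by
    have h₁ : ∫ x, h x ∂(Measure.map L volume) = ∫ x, h (L x) :=
      L.toHomeomorph.measurableEmbedding.integral_map h
    rw [← h₁]
    refine (congrArg (fun ν : Measure (ℝ × ℝ) => ∫ x, h x ∂ν) hmap).trans ?_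
    rw [integral_smul_measure, ENNReal.toReal_ofReal hc.le, real_smul]
  have h₂ : ∀ x, f x * ((c : ℂ) • compLin L.symm) φ x = c * (f x * φ (L.symm x)) :=
    fun x => mul_left_comm ..
  simp only [h₂]
  rw [integral_const_mul, ← hcv]
  simp

lemma isUnit_smulLeftCLM {m m' : Fn2} (hm : m.HasTemperateGrowth) (hm' : m'.HasTemperateGrowth)
    (h : ∀ x, m x * m' x = 1) : IsUnit (smulLeftCLM ℂ m : End2) := by
  refine ⟨⟨smulLeftCLM ℂ m, smulLeftCLM ℂ m', ?_, ?_⟩, rfl⟩ <;> ext f x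
  · simp [smulLeftCLM_apply_apply hm, smulLeftCLM_apply_apply hm', ← mul_assoc, h]
  · simp [smulLeftCLM_apply_apply hm, smulLeftCLM_apply_apply hm', ← mul_assoc,
      (mul_comm _ _).trans (h x)]
/-- A continuous seminorm on `𝓢(ℝ²)` controlling `sup (1 + |x|²) |f x|`. -/
def decaySeminorm : Seminorm ℂ S2 := SchwartzMap.seminorm ℂ 0 0 + SchwartzMap.seminorm ℂ 2 0

lemma continuous_decaySeminorm : Continuous decaySeminorm :=
  ((schwartz_withSeminorms ℂ (ℝ × ℝ) ℂ).continuous_seminorm (0, 0)).add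
    ((schwartz_withSeminorms ℂ (ℝ × ℝ) ℂ).continuous_seminorm (2, 0))

lemma norm_le_decaySeminorm (f : S2) (x t : ℝ) :
    ‖f (x, t)‖ ≤ decaySeminorm f * (1 + t ^ 2)⁻¹ := by
  have h₀ := norm_pow_mul_le_seminorm ℂ f 0 (x, t)
  have h₂ := norm_pow_mul_le_seminorm ℂ f 2 (x, t)
  have ht : t ^ 2 ≤ ‖(x, t)‖ ^ 2 := by
    rw [← sq_abs]
    gcongr
    exact norm_snd_le (x, t)
  rw [pow_zero, one_mul] at h₀
  rw [← div_eq_mul_inv, le_div_iff₀ (by positivity)]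
  have h := mul_le_mul_of_nonneg_right ht (norm_nonneg (f (x, t)))
  change _ ≤ SchwartzMap.seminorm ℂ 0 0 f + SchwartzMap.seminorm ℂ 2 0 f
  linarith

lemma exists_sum_le_sup_seminorm (p : Seminorm ℂ S2) (hp : Continuous p) (l : List End2) :
    ∃ (s : Finset (ℕ × ℕ)) (C : ℝ), 0 ≤ C ∧ ∀ f : S2, (l.map fun m => p (m f)).sum ≤
      C * s.sup (schwartzSeminormFamily ℂ (ℝ × ℝ) ℂ) f := by
  obtain ⟨Q, hQ, hQl⟩ : ∃ Q : Seminorm ℂ S2, Continuous Q ∧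
      ∀ f : S2, (l.map fun m => p (m f)).sum = Q f := by
    induction l with
    | nil => exact ⟨0, continuous_zero, fun f => rfl⟩
    | cons m l ih =>
      obtain ⟨Q, hQ, hQl⟩ := ih
      refine ⟨p.comp (m : S2 →ₗ[ℂ] S2) + Q, (hp.comp m.continuous).add hQ, fun f => ?_⟩
      rw [List.map_cons, List.sum_cons, hQl]
      rfl
  obtain ⟨s, C, -, h⟩ := Seminorm.bound_of_continuous (schwartz_withSeminorms ℂ (ℝ × ℝ) ℂ) Q hQ
  exact ⟨s, C, C.2, fun f => (hQl f).trans_le (h f)⟩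

lemma norm_exp_neg_I_mul_mul (t y : ℝ) : ‖Complex.exp (-Complex.I * t * y)‖ = 1 := by
  rw [show -Complex.I * t * y = ((-(t * y) : ℝ) : ℂ) * Complex.I by push_cast; ring,
    norm_exp_ofReal_mul_I]

lemma integrable_slice (f : S2) (x : ℝ) : Integrable fun t : ℝ => f (x, t) := by
  refine (integrable_inv_one_add_sq.const_mul (decaySeminorm f)).mono'
    (f.continuous.comp (by fun_prop)).aestronglyMeasurable (.of_forall fun t => ?_)
  exact norm_le_decaySeminorm f x t

lemma integrable_exp_mul_slice (f : S2) (x y : ℝ) :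
    Integrable fun t : ℝ => Complex.exp (-Complex.I * t * y) * f (x, t) := by
  refine (integrable_slice f x).norm.mono' ?_ (.of_forall fun t => ?_)
  · exact (Continuous.mul (by fun_prop) (f.continuous.comp (by fun_prop))).aestronglyMeasurable
  · rw [norm_mul, norm_exp_neg_I_mul_mul, one_mul]

/-- The Fourier integral in the second variable. -/
def partialFourierFun (f : Fn2) : Fn2 :=
  fun p => ∫ t : ℝ, Complex.exp (-Complex.I * t * p.2) * f (p.1, t)

lemma norm_partialFourierFun_le (f : S2) (p : ℝ × ℝ) :
    ‖partialFourierFun f p‖ ≤ (Real.toNNReal Real.pi • decaySeminorm) f := by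
  refine (norm_integral_le_of_norm_le
    (integrable_inv_one_add_sq.const_mul (decaySeminorm f)) (.of_forall fun t => ?_)).trans ?_
  · rw [norm_mul, norm_exp_neg_I_mul_mul, one_mul]
    exact norm_le_decaySeminorm f p.1 t
  · rw [integral_const_mul, integral_univ_inv_one_add_sq, mul_comm]
    change _ ≤ (Real.toNNReal Real.pi : ℝ) * decaySeminorm f
    rw [Real.coe_toNNReal _ Real.pi_nonneg]

lemma norm_pairCLM_le (a b : ℂ) : ‖pairCLM a b‖ ≤ ‖a‖ + ‖b‖ := by
  refine ContinuousLinearMap.opNorm_le_bound _ (by positivity) fun v => ?_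
  rw [pairCLM_apply, add_mul]
  refine (norm_add_le _ _).trans (add_le_add ?_ ?_) <;>
    rw [norm_mul, Complex.norm_real, mul_comm] <;> gcongr
  exacts [norm_fst_le v, norm_snd_le v]

lemma hasFDerivAt_partialFourierFun (f : S2) (p : ℝ × ℝ) :
    HasFDerivAt (partialFourierFun f) (pairCLM (partialFourierFun (der₁ f) p)
      (partialFourierFun (((-Complex.I) • mulX₂) f) p)) p := by
  set g := ((-Complex.I) • mulX₂) f with hg
  have hgx : ∀ x, g x = -Complex.I * (x.2 * f x) := fun x => by
    rw [← mulX₂_apply]; rfl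
  let F : ℝ × ℝ → ℝ → ℂ := fun p t => Complex.exp (-Complex.I * t * p.2) * f (p.1, t)
  let F' : ℝ × ℝ → ℝ → (ℝ × ℝ →L[ℝ] ℂ) := fun p t =>
    pairCLM (Complex.exp (-Complex.I * t * p.2) * der₁ f (p.1, t))
      (Complex.exp (-Complex.I * t * p.2) * g (p.1, t))
  have hcont : Continuous fun ab : ℂ × ℂ => pairCLM ab.1 ab.2 := by
    unfold pairCLM
    exact ((ContinuousLinearMap.smulRightL ℝ (ℝ × ℝ) ℂ
      (ContinuousLinearMap.fst ℝ ℝ ℝ)).continuous.comp continuous_fst).add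
      ((ContinuousLinearMap.smulRightL ℝ (ℝ × ℝ) ℂ
      (ContinuousLinearMap.snd ℝ ℝ ℝ)).continuous.comp continuous_snd)
  have hF'c : ∀ p, Continuous (F' p) := fun p => by
    refine hcont.comp (Continuous.prodMk ?_ ?_) <;>
    exact Continuous.mul (by fun_prop) ((SchwartzMap.continuous _).comp (by fun_prop))
  have hbound : ∀ p t, ‖F' p t‖ ≤
      decaySeminorm (der₁ f) * (1 + t ^ 2)⁻¹ + decaySeminorm g * (1 + t ^ 2)⁻¹ := fun p t => by
    refine (norm_pairCLM_le _ _).trans ?_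
    rw [norm_mul, norm_mul, norm_exp_neg_I_mul_mul, one_mul, one_mul]
    exact add_le_add (norm_le_decaySeminorm _ _ _) (norm_le_decaySeminorm _ _ _)
  have hbi : Integrable fun t : ℝ =>
      decaySeminorm (der₁ f) * (1 + t ^ 2)⁻¹ + decaySeminorm g * (1 + t ^ 2)⁻¹ :=
    (integrable_inv_one_add_sq.const_mul _).add (integrable_inv_one_add_sq.const_mul _)
  have hF'i : Integrable (F' p) :=
    hbi.mono' (hF'c p).aestronglyMeasurable (.of_forall (hbound p))
  have key : HasFDerivAt (fun p => ∫ t, F p t) (∫ t, F' p t) p := by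
    refine hasFDerivAt_integral_of_dominated_of_fderiv_le (s := Set.univ) Filter.univ_mem
      (.of_forall fun p => (integrable_exp_mul_slice f p.1 p.2).aestronglyMeasurable)
      (integrable_exp_mul_slice f p.1 p.2) (hF'c p).aestronglyMeasurable
      (.of_forall fun t p _ => hbound p t) hbi (.of_forall fun t p _ => ?_)
    have h₁ : HasFDerivAt (fun p : ℝ × ℝ => (p.1, t))
        ((ContinuousLinearMap.fst ℝ ℝ ℝ).prod 0) p :=
      hasFDerivAt_fst.prodMk (hasFDerivAt_const _ _)
    have h₂ : HasFDerivAt (fun p : ℝ × ℝ => f (p.1, t)) (pairCLM (der₁ f (p.1, t)) 0) p := by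
      refine ((hasFDerivAt_schwartz f (p.1, t)).comp p h₁).congr_fderiv ?_
      ext <;> simp
    have h₃ : HasFDerivAt (fun p : ℝ × ℝ => Complex.exp (-Complex.I * t * p.2))
        (pairCLM 0 (Complex.exp (-Complex.I * t * p.2) * (-Complex.I * t))) p := by
      have h := ((Complex.ofRealCLM.comp (ContinuousLinearMap.snd ℝ ℝ ℝ)).hasFDerivAt
        (x := p)).const_mul (-Complex.I * t)
      refine h.cexp.congr_fderiv ?_
      ext <;> simp
    refine (h₃.mul h₂).congr_fderiv (ContinuousLinearMap.ext fun v => ?_)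
    simp only [F', hgx, add_apply, smul_apply,
      pairCLM_apply, smul_eq_mul]
    ring
  refine key.congr_fderiv (ContinuousLinearMap.ext fun v => ?_)
  rw [ContinuousLinearMap.integral_apply hF'i]
  simp only [F', pairCLM_apply]
  rw [integral_add ((integrable_exp_mul_slice _ _ _).const_mul _)
    ((integrable_exp_mul_slice _ _ _).const_mul _), integral_const_mul, integral_const_mul]
  rfl

lemma partialFourierFun_mulX₁ (f : S2) (p : ℝ × ℝ) :
    partialFourierFun (mulX₁ f) p = p.1 * partialFourierFun f p := by
  simp only [partialFourierFun, mulX₁_apply, ← integral_const_mul]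
  exact integral_congr_ae (.of_forall fun t => by ring)

lemma hasDerivAt_slice (f : S2) (x t : ℝ) :
    HasDerivAt (fun t : ℝ => f (x, t)) (der₂ f (x, t)) t := by
  have h₁ : HasDerivAt (fun t : ℝ => (x, t)) ((0 : ℝ), (1 : ℝ)) t :=
    (hasDerivAt_const _ _).prodMk (hasDerivAt_id t)
  exact ((hasFDerivAt_schwartz f (x, t)).comp_hasDerivAt t h₁).congr_deriv (by simp)

lemma partialFourierFun_smul_der₂ (f : S2) (p : ℝ × ℝ) :
    partialFourierFun (((-Complex.I) • der₂) f) p = p.2 * partialFourierFun f p := by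
  have he : ∀ t : ℝ, HasDerivAt (fun t : ℝ => Complex.exp (-Complex.I * t * p.2))
      (Complex.exp (-Complex.I * t * p.2) * (-Complex.I * p.2)) t := fun t => by
    have h := ((Complex.ofRealCLM.hasDerivAt (x := t)).const_mul (-Complex.I)).mul_const
      (p.2 : ℂ)
    simpa using h.cexp
  have h0 := integral_eq_zero_of_hasDerivAt_of_integrable (fun t => (he t).mul (hasDerivAt_slice f p.1 t)) ?_
    (integrable_exp_mul_slice f p.1 p.2)
  · have hsplit : ∀ t : ℝ, Complex.exp (-Complex.I * t * p.2) * (-Complex.I * p.2) * f (p.1, t) +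
        Complex.exp (-Complex.I * t * p.2) * der₂ f (p.1, t) =
        -Complex.I * p.2 * (Complex.exp (-Complex.I * t * p.2) * f (p.1, t)) +
        Complex.exp (-Complex.I * t * p.2) * der₂ f (p.1, t) := fun t => by ring
    simp only [hsplit] at h0
    rw [integral_add ((integrable_exp_mul_slice _ _ _).const_mul _)
      (integrable_exp_mul_slice _ _ _), integral_const_mul] at h0
    have h1 : partialFourierFun (((-Complex.I) • der₂) f) p =
        -Complex.I * partialFourierFun (der₂ f) p := by
      simp only [partialFourierFun, ← integral_const_mul]
      exact integral_congr_ae (.of_forall fun t => mul_left_comm _ _ _)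
    change -Complex.I * p.2 * partialFourierFun f p + partialFourierFun (der₂ f) p = 0 at h0
    rw [h1]
    linear_combination (-Complex.I) * h0 - p.2 * partialFourierFun f p * Complex.I_mul_I
  · refine Integrable.add ?_ (integrable_exp_mul_slice (der₂ f) p.1 p.2)
    refine ((integrable_exp_mul_slice f p.1 p.2).const_mul (-Complex.I * p.2)).congr
      (.of_forall fun t => ?_)
    ring

/-- The Fourier transform in the second variable on the Schwartz space. -/
def partialFourier : End2 :=
  mkCLM (fun f => partialFourierFun f)
    (fun f g p => by
      have h : ∀ t : ℝ, Complex.exp (-Complex.I * t * p.2) * (f + g) (p.1, t) =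
          Complex.exp (-Complex.I * t * p.2) * f (p.1, t) +
          Complex.exp (-Complex.I * t * p.2) * g (p.1, t) := fun t => mul_add ..
      simp only [partialFourierFun, h]
      exact integral_add (integrable_exp_mul_slice _ _ _) (integrable_exp_mul_slice _ _ _))
    (fun a f p => by
      have h : ∀ t : ℝ, Complex.exp (-Complex.I * t * p.2) * (a • f) (p.1, t) =
          a * (Complex.exp (-Complex.I * t * p.2) * f (p.1, t)) := fun t => mul_left_comm ..
      simp only [partialFourierFun, h, integral_const_mul]
      rfl)
    (fun f => contDiff_infty.2 fun n =>
      (contDiff_and_norm_iteratedFDeriv_le (M := End2) ⊤ (Submonoid.mem_top der₁)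
        (Submonoid.mem_top ((-Complex.I) • mulX₂)) (fun f : S2 => partialFourierFun f)
        hasFDerivAt_partialFourierFun n).1 f)
    (fun ⟨k, n⟩ => by
      obtain ⟨l, -, hl⟩ := norm_pow_mul_norm_iteratedFDeriv_le (M := End2) ⊤
        (Submonoid.mem_top der₁) (Submonoid.mem_top ((-Complex.I) • mulX₂))
        (Submonoid.mem_top mulX₁) (Submonoid.mem_top ((-Complex.I) • der₂))
        (fun f : S2 => partialFourierFun f) hasFDerivAt_partialFourierFun
        partialFourierFun_mulX₁ partialFourierFun_smul_der₂ _ norm_partialFourierFun_le k n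
      obtain ⟨s, C, hC, h⟩ := exists_sum_le_sup_seminorm (Real.toNNReal Real.pi • decaySeminorm)
        (continuous_decaySeminorm.const_smul _) l
      exact ⟨s, C, hC, fun f x => (hl f x).trans (h f)⟩)

lemma partialFourier_apply (f : S2) : ⇑(partialFourier f) = partialFourierFun f := rfl
lemma isTranspose_partialFourier : IsTranspose partialFourier partialFourier := fun f φ => by
  have hint := integrable_mul_schwartz
  rw [Measure.volume_eq_prod, integral_prod _ (hint (partialFourier f) φ),
    integral_prod _ (hint f (partialFourier φ))]
  refine integral_congr_ae (.of_forall fun x => ?_)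
  have h₁ : ∀ y : ℝ, partialFourier f (x, y) * φ (x, y) =
      ∫ t : ℝ, Complex.exp (-Complex.I * t * y) * (f (x, t) * φ (x, y)) := fun y => by
    rw [partialFourier_apply, partialFourierFun, ← integral_mul_const]
    simp only [mul_assoc]
  have h₂ : ∀ t : ℝ, f (x, t) * partialFourier φ (x, t) =
      ∫ y : ℝ, Complex.exp (-Complex.I * t * y) * (f (x, t) * φ (x, y)) := fun t => by
    rw [partialFourier_apply, partialFourierFun, ← integral_const_mul]
    refine integral_congr_ae (.of_forall fun y => ?_)
    dsimp only
    rw [mul_right_comm (-Complex.I)]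
    ring
  simp only [h₁, h₂]
  refine integral_integral_swap ?_
  have hi := ((integrable_slice φ x).mul_prod (integrable_slice f x))
  refine hi.norm.mono' ?_ (.of_forall fun z => ?_)
  · refine Continuous.aestronglyMeasurable (Continuous.mul ?_ (Continuous.mul ?_ ?_))
    · fun_prop
    · exact f.continuous.comp (by fun_prop)
    · exact φ.continuous.comp (by fun_prop)
  · simp only [Function.uncurry, norm_mul, norm_exp_neg_I_mul_mul, one_mul]
    rw [mul_comm]

/-- The reflection `(x, y) ↦ (x, -y)`. -/
def reflSnd : (ℝ × ℝ) ≃L[ℝ] ℝ × ℝ :=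
  (ContinuousLinearEquiv.refl ℝ ℝ).prodCongr (ContinuousLinearEquiv.neg ℝ)

/-- The swap `(x, y) ↦ (y, x)`. -/
def swapEquiv : (ℝ × ℝ) ≃L[ℝ] ℝ × ℝ := ContinuousLinearEquiv.prodComm ℝ ℝ ℝ

open FourierTransform in
lemma fourier_slice (f : S2) (x v : ℝ) :
    𝓕 (fun t : ℝ => f (x, t)) v = partialFourier f (x, 2 * Real.pi * v) := by
  rw [Real.fourier_real_eq_integral_exp_smul, partialFourier_apply, partialFourierFun]
  refine integral_congr_ae (.of_forall fun t => ?_)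
  simp only [smul_eq_mul]
  congr 2
  push_cast
  ring

open FourierTransform in
/-- Fourier inversion for the partial Fourier transform. -/
lemma integral_exp_mul_partialFourier (f : S2) (x y : ℝ) :
    ∫ t : ℝ, Complex.exp (Complex.I * t * y) * partialFourier f (x, t) =
      2 * Real.pi * f (x, y) := by
  have hpi : (2 * Real.pi : ℝ) ≠ 0 := by positivity
  have hc : Continuous fun t : ℝ => f (x, t) := f.continuous.comp (by fun_prop)
  have hF : 𝓕 (fun t : ℝ => f (x, t)) = fun v => partialFourier f (x, 2 * Real.pi * v) :=
    funext (fourier_slice f x)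
  have hi : Integrable (𝓕 (fun t : ℝ => f (x, t))) := by
    rw [hF]
    exact (integrable_slice (partialFourier f) x).comp_mul_left' hpi
  have h := congrFun (hc.fourierInv_fourier_eq (integrable_slice f x) hi) y
  rw [hF, Real.fourierInv_eq'] at h
  rw [← h]
  have h' := Measure.integral_comp_mul_left
    (fun t : ℝ => Complex.exp (Complex.I * t * y) * partialFourier f (x, t)) (2 * Real.pi)
  rw [abs_of_pos (by positivity), eq_inv_smul_iff₀ hpi, real_smul] at h'
  rw [← h']
  push_cast
  congr 1
  refine integral_congr_ae (.of_forall fun v => ?_)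
  simp only [smul_eq_mul, RCLike.inner_apply, conj_trivial]
  congr 2
  push_cast
  ring

lemma partialFourier_mul_comp_mul_partialFourier :
    partialFourier * compLin reflSnd * partialFourier =
      ((2 * Real.pi : ℝ) : ℂ) • 1 := by
  ext f ⟨x, y⟩
  have h : ((((2 * Real.pi : ℝ) : ℂ) • (1 : End2)) f) (x, y) =
      ((2 * Real.pi : ℝ) : ℂ) * f (x, y) := rfl
  rw [h, Complex.ofReal_mul, Complex.ofReal_ofNat, ← integral_exp_mul_partialFourier,
    ← integral_neg_eq_self]
  refine integral_congr_ae (.of_forall fun t => ?_)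
  change Complex.exp (-Complex.I * t * y) * partialFourier f (x, -t) = _
  push_cast
  congr 2
  ring

lemma isUnit_partialFourier : IsUnit partialFourier := by
  have hpi : ((2 * Real.pi : ℝ) : ℂ) ≠ 0 := by exact_mod_cast (by positivity)
  have h := partialFourier_mul_comp_mul_partialFourier
  obtain ⟨u, hu⟩ : IsUnit (((2 * Real.pi : ℝ) : ℂ) • (1 : End2)) :=
    isUnit_one.smul (Units.mk0 _ hpi)
  rw [← hu] at h
  have h₁ : partialFourier * (compLin reflSnd * partialFourier * ↑u⁻¹) = 1 := by
    rw [← mul_assoc, ← mul_assoc, h, Units.mul_inv]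
  have h₂ : ↑u⁻¹ * (partialFourier * compLin reflSnd) * partialFourier = 1 := by
    rw [mul_assoc, h, Units.inv_mul]
  have h₃ := left_inv_eq_right_inv h₂ h₁
  exact ⟨⟨partialFourier, _, h₁, h₃ ▸ h₂⟩, rfl⟩

/-- The map `(x, t) ↦ (x + t / 2, x - t / 2)`. -/
def wigEquiv : (ℝ × ℝ) ≃L[ℝ] ℝ × ℝ :=
  LinearEquiv.toContinuousLinearEquiv
    { toFun := fun p => (p.1 + p.2 / 2, p.1 - p.2 / 2)
      invFun := fun p => ((p.1 + p.2) / 2, p.1 - p.2)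
      map_add' := fun p p' => by ext <;> simp <;> ring
      map_smul' := fun c p => by ext <;> simp <;> ring
      left_inv := fun p => by ext <;> simp
      right_inv := fun p => by ext <;> simp <;> ring }

lemma Wig_eq (f : S2) : Wig f = partialFourier (compLin wigEquiv f) := rfl

/-- The Fourier transform on `𝓢(ℝ²)`. -/
def fourierEnd : End2 :=
  compLin swapEquiv * partialFourier * compLin swapEquiv * partialFourier

lemma FT2_eq (f : S2) : FT2 f = fourierEnd f := by
  funext ξ
  change _ = ∫ t : ℝ, Complex.exp (-Complex.I * t * ξ.1) * partialFourierFun f (t, ξ.2)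
  rw [FT2, Measure.volume_eq_prod, integral_prod]
  · refine integral_congr_ae (.of_forall fun x => ?_)
    dsimp only
    rw [partialFourierFun, ← integral_const_mul]
    refine integral_congr_ae (.of_forall fun y => ?_)
    dsimp only
    rw [← mul_assoc, ← Complex.exp_add]
    congr 2
    push_cast
    ring
  · refine f.integrable.norm.mono' ?_ (.of_forall fun z => ?_)
    · exact (Continuous.mul (by fun_prop) f.continuous).aestronglyMeasurable
    · rw [norm_mul, show -Complex.I * ((z.1 * ξ.1 + z.2 * ξ.2 : ℝ) : ℂ) =
        ((-(z.1 * ξ.1 + z.2 * ξ.2) : ℝ) : ℂ) * Complex.I by push_cast; ring,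
        norm_exp_ofReal_mul_I, one_mul]

lemma FT2inv_eq (g : S2) :
    FT2inv g = ((((2 * Real.pi : ℝ) : ℂ)⁻¹ ^ 2) • (compLin (ContinuousLinearEquiv.neg ℝ) * fourierEnd)) g := by
  funext x
  have : ((((2 * Real.pi : ℝ) : ℂ)⁻¹ ^ 2) • (compLin (ContinuousLinearEquiv.neg ℝ) * fourierEnd)) g x
    = ((2 * Real.pi : ℝ) : ℂ)⁻¹ ^ 2 * fourierEnd g (-x) := rfl
  rw [this, ← FT2_eq, FT2, FT2inv]
  congr 1
  refine integral_congr_ae (.of_forall fun ξ => ?_)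
  simp only [Prod.fst_neg, Prod.snd_neg]
  congr 2
  push_cast
  ring

/-- Invertible operators on `𝓢(ℝ²)` with an invertible transpose. -/
def UnitsWithTranspose : Submonoid End2 where
  carrier := {A | IsUnit A ∧ ∃ B, IsUnit B ∧ IsTranspose A B}
  one_mem' := ⟨isUnit_one, 1, isUnit_one, .one⟩
  mul_mem' := fun ⟨hA, _, hB, h⟩ ⟨hA', _, hB', h'⟩ => ⟨hA.mul hA', _, hB'.mul hB, h.mul h'⟩

lemma compLin_mem_unitsWithTranspose (L : (ℝ × ℝ) ≃L[ℝ] ℝ × ℝ) :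
    compLin L ∈ UnitsWithTranspose :=
  ⟨isUnit_compLin L, exists_isTranspose_compLin L⟩

lemma partialFourier_mem_unitsWithTranspose : partialFourier ∈ UnitsWithTranspose :=
  ⟨isUnit_partialFourier, _, isUnit_partialFourier, isTranspose_partialFourier⟩

lemma fourierEnd_mem_unitsWithTranspose : fourierEnd ∈ UnitsWithTranspose := by
  have h := mul_mem (compLin_mem_unitsWithTranspose swapEquiv) partialFourier_mem_unitsWithTranspose
  exact mul_mem (mul_mem h (compLin_mem_unitsWithTranspose _)) partialFourier_mem_unitsWithTranspose

lemma smul_mem_unitsWithTranspose {A : End2} (hA : A ∈ UnitsWithTranspose) {c : ℂ} (hc : c ≠ 0) :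
    c • A ∈ UnitsWithTranspose := by
  obtain ⟨hA, B, hB, h⟩ := hA
  exact ⟨hA.smul (Units.mk0 c hc), _, hB.smul (Units.mk0 c hc), h.smul c⟩

/-- `Qrep1 q P` is given on Schwartz functions by an invertible operator with an invertible
transpose. -/
theorem exists_end_eq_Qrep1 (P : MvPolynomial (Fin 2) ℝ) {q : MvPolynomial (Fin 2) ℂ}
    (hq : ∀ ξ : ℝ × ℝ, qval q ξ ≠ 0) :
    ∃ A ∈ UnitsWithTranspose, ∀ f : S2, ⇑(A f) = Qrep1 q P f := by
  have hL := exists_norm_inv_qval_le hq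
  have hm := hasTemperateGrowth_oscQuot P hq hL (q, 0)
  have hm' := hasTemperateGrowth_oscQuot (-P) hq hL (1, 1)
  have hmm : ∀ x, oscQuot P q (q, 0) x * oscQuot (-P) q (1, 1) x = 1 := fun x => by
    have h : Pval (-P) x = -Pval P x := map_neg _ _
    have h1 : qval 1 x = 1 := map_one _
    simp only [oscQuot, h, h1, pow_zero, mul_one, one_mul, pow_one]
    have he : Complex.exp (-Complex.I * (Pval P x : ℝ)) *
        Complex.exp (-Complex.I * (-Pval P x : ℝ)) = 1 := by
      rw [← Complex.exp_add]
      simp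
    have hx := mul_inv_cancel₀ (hq x)
    linear_combination (qval q x * (qval q x)⁻¹) * he + hx
  have hmem : (smulLeftCLM ℂ (oscQuot P q (q, 0)) : End2) ∈ UnitsWithTranspose :=
    ⟨isUnit_smulLeftCLM hm hm' hmm, _, isUnit_smulLeftCLM hm hm' hmm, isTranspose_smulLeftCLM hm⟩
  refine ⟨_, mul_mem (smul_mem_unitsWithTranspose (mul_mem (compLin_mem_unitsWithTranspose
    (ContinuousLinearEquiv.neg ℝ)) fourierEnd_mem_unitsWithTranspose)
      (c := ((2 * Real.pi : ℝ) : ℂ)⁻¹ ^ 2) (by simp [Real.pi_ne_zero]))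
    (mul_mem hmem (mul_mem fourierEnd_mem_unitsWithTranspose (mul_mem
      partialFourier_mem_unitsWithTranspose (compLin_mem_unitsWithTranspose wigEquiv)))),
    fun f => ?_⟩
  refine (FT2inv_eq _).symm.trans ?_
  rw [Qrep1, Wig_eq, FT2_eq]
  congr 1
  funext ξ
  refine (smulLeftCLM_apply_apply hm _ _).trans ?_
  simp [oscQuot]
lemma norm_le_integral_norm_deriv {g g' : ℝ → ℂ} (hd : ∀ t, HasDerivAt g (g' t) t)
    (hg : Integrable g) (hg' : Integrable g') (t : ℝ) : ‖g t‖ ≤ ∫ s, ‖g' s‖ := by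
  have h := integral_Iic_of_hasDerivAt_of_tendsto' (a := t) (fun x _ => hd x) hg'.integrableOn
    (tendsto_zero_of_hasDerivAt_of_integrableOn_Iic (a := t) (fun x _ => hd x)
      hg'.integrableOn hg.integrableOn)
  rw [sub_zero] at h
  rw [← h]
  exact (norm_integral_le_integral_norm _).trans
    (setIntegral_le_integral hg'.norm (.of_forall fun _ => norm_nonneg _))

lemma norm_le_integral_norm_der₂_der₁ (f : S2) (x : ℝ × ℝ) :
    ‖f x‖ ≤ ∫ z, ‖der₂ (der₁ f) z‖ := by
  have hd₁ : ∀ t : ℝ, HasDerivAt (fun t : ℝ => f (t, x.2)) (der₁ f (t, x.2)) t := fun t => by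
    have h₁ : HasDerivAt (fun t : ℝ => (t, x.2)) ((1 : ℝ), (0 : ℝ)) t :=
      (hasDerivAt_id t).prodMk (hasDerivAt_const _ _)
    exact ((hasFDerivAt_schwartz f (t, x.2)).comp_hasDerivAt t h₁).congr_deriv (by simp)
  have hint : Integrable (der₂ (der₁ f)) (volume.prod volume) :=
    (der₂ (der₁ f)).integrable (μ := volume)
  have h₁ := norm_le_integral_norm_deriv hd₁ (integrable_slice (compLin swapEquiv f) x.2)
    (integrable_slice (compLin swapEquiv (der₁ f)) x.2) x.1
  refine h₁.trans ?_
  rw [Measure.volume_eq_prod, integral_prod _ hint.norm]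
  refine integral_mono (integrable_slice (compLin swapEquiv (der₁ f)) x.2).norm
    hint.integral_norm_prod_left fun s => ?_
  exact norm_le_integral_norm_deriv (hasDerivAt_slice (der₁ f) s)
    (integrable_slice (der₁ f) s) (integrable_slice (der₂ (der₁ f)) s) x.2

/-- Multiplication by `(1 + x²) (1 + y²)`. -/
def mulWeight : End2 := (1 + mulX₁ * mulX₁) * (1 + mulX₂ * mulX₂)

lemma mulWeight_apply (f : S2) (x : ℝ × ℝ) :
    mulWeight f x = ((1 + x.1 ^ 2 : ℝ) : ℂ) * ((1 + x.2 ^ 2 : ℝ) : ℂ) * f x := by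
  have h₁ : ∀ g : S2, ((1 + mulX₁ * mulX₁ : End2) g) x = g x + mulX₁ (mulX₁ g) x := fun g => rfl
  have h₂ : ((1 + mulX₂ * mulX₂ : End2) f) x = f x + mulX₂ (mulX₂ f) x := rfl
  have h₀ : mulWeight f x =
      ((1 + mulX₁ * mulX₁ : End2) ((1 + mulX₂ * mulX₂ : End2) f)) x := rfl
  rw [h₀, h₁, mulX₁_apply, mulX₁_apply, h₂, mulX₂_apply,
    mulX₂_apply]
  push_cast
  ring

lemma integral_norm_le_norm_toLp_mulWeight :
    ∃ C : ℝ, 0 ≤ C ∧ ∀ f : S2, ∫ x, ‖f x‖ ≤ C * ‖(mulWeight f).toLp 2‖ := by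
  let w : ℝ × ℝ → ℝ := fun x => (1 + x.1 ^ 2)⁻¹ * (1 + x.2 ^ 2)⁻¹
  have hw0 : ∀ x, 0 < w x := fun x => by positivity
  have hw1 : ∀ x, w x ≤ 1 := fun x => mul_le_one₀ (inv_le_one_of_one_le₀ (by nlinarith))
    (by positivity) (inv_le_one_of_one_le₀ (by nlinarith))
  have hwc : Continuous w :=
    (Continuous.inv₀ (by fun_prop) fun x => by positivity).mul
      (Continuous.inv₀ (by fun_prop) fun x => by positivity)
  have hwi : Integrable w := integrable_inv_one_add_sq.mul_prod integrable_inv_one_add_sq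
  have hw2 : MemLp w 2 := by
    rw [memLp_two_iff_integrable_sq hwc.aestronglyMeasurable]
    refine hwi.mono' (by fun_prop) (.of_forall fun x => ?_)
    rw [Real.norm_of_nonneg (by positivity)]
    nlinarith [hw0 x, hw1 x]
  refine ⟨(∫ x, w x ^ (2 : ℝ)) ^ (1 / 2 : ℝ), by positivity, fun f => ?_⟩
  have h := integral_mul_le_Lp_mul_Lq_of_nonneg (μ := volume) (f := w)
    (g := fun x => ‖mulWeight f x‖) Real.HolderConjugate.two_two (.of_forall fun x => (hw0 x).le)
    (.of_forall fun x => norm_nonneg _) (by simpa using hw2)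
    (by simpa using ((mulWeight f).memLp 2 volume).norm)
  have hl : ∀ x, w x * ‖mulWeight f x‖ = ‖f x‖ := fun x => by
    rw [mulWeight_apply, norm_mul, norm_mul, Complex.norm_real, Complex.norm_real,
      Real.norm_of_nonneg (by positivity), Real.norm_of_nonneg (by positivity)]
    simp only [w]
    have h1 : (1 + x.1 ^ 2) ≠ 0 := by positivity
    have h2 : (1 + x.2 ^ 2) ≠ 0 := by positivity
    field_simp
  simp only [hl] at h
  rw [norm_toLp' (by simp) (by simp)]
  simpa using h

/-- Operators admitting a transpose. -/
def HasTranspose : Submonoid End2 where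
  carrier := {A | ∃ B, IsTranspose A B}
  one_mem' := ⟨1, .one⟩
  mul_mem' := fun ⟨_, h⟩ ⟨_, h'⟩ => ⟨_, h.mul h'⟩

lemma mulX₁_mem_hasTranspose : mulX₁ ∈ HasTranspose :=
  ⟨_, isTranspose_smulLeftCLM hasTemperateGrowth_ofReal_fst⟩

lemma mulX₂_mem_hasTranspose : mulX₂ ∈ HasTranspose :=
  ⟨_, isTranspose_smulLeftCLM hasTemperateGrowth_ofReal_snd⟩

lemma der₁_mem_hasTranspose : der₁ ∈ HasTranspose := ⟨_, isTranspose_lineDeriv _⟩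

lemma der₂_mem_hasTranspose : der₂ ∈ HasTranspose := ⟨_, isTranspose_lineDeriv _⟩

lemma mulWeight_mem_hasTranspose : mulWeight ∈ HasTranspose := by
  obtain ⟨B₁, h₁⟩ := mul_mem mulX₁_mem_hasTranspose mulX₁_mem_hasTranspose
  obtain ⟨B₂, h₂⟩ := mul_mem mulX₂_mem_hasTranspose mulX₂_mem_hasTranspose
  exact ⟨_, (IsTranspose.one.add h₁).mul (IsTranspose.one.add h₂)⟩

lemma exists_norm_le_norm_toLp :
    ∃ N ∈ HasTranspose, ∃ C : ℝ, 0 ≤ C ∧ ∀ (f : S2) (x : ℝ × ℝ), ‖f x‖ ≤ C * ‖(N f).toLp 2‖ := by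
  obtain ⟨C, hC, hw⟩ := integral_norm_le_norm_toLp_mulWeight
  exact ⟨mulWeight * (der₂ * der₁), mul_mem mulWeight_mem_hasTranspose
      (mul_mem der₂_mem_hasTranspose der₁_mem_hasTranspose), C, hC,
    fun f x => (norm_le_integral_norm_der₂_der₁ f x).trans (hw (der₂ (der₁ f)))⟩

lemma exists_pow_mul_norm_iteratedFDeriv_le_sum {p : S2 → ℝ}
    (hp : ∀ (f : S2) (x : ℝ × ℝ), ‖f x‖ ≤ p f) (k n : ℕ) :
    ∃ l : List End2, (∀ m ∈ l, m ∈ HasTranspose) ∧ ∀ (f : S2) (x : ℝ × ℝ),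
      ‖x‖ ^ k * ‖iteratedFDeriv ℝ n f x‖ ≤ (l.map fun m => p (m f)).sum :=
  norm_pow_mul_norm_iteratedFDeriv_le (M := End2) (ι := S2) HasTranspose
    der₁_mem_hasTranspose der₂_mem_hasTranspose mulX₁_mem_hasTranspose mulX₂_mem_hasTranspose
    (fun f : S2 => ⇑f) hasFDerivAt_schwartz mulX₁_apply mulX₂_apply p hp k n

/-- The Schwartz seminorms are controlled by `L²`-norms. -/
lemma exists_seminorm_le_sum_norm_toLp (k n : ℕ) :
    ∃ l : List End2, (∀ m ∈ l, m ∈ HasTranspose) ∧ ∃ C : ℝ, 0 ≤ C ∧ ∀ f : S2,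
      SchwartzMap.seminorm ℂ k n f ≤ C * (l.map fun m => ‖(m f).toLp 2‖).sum := by
  obtain ⟨N, hN, C, hC, hNC⟩ := exists_norm_le_norm_toLp
  obtain ⟨l, hl, hb⟩ := exists_pow_mul_norm_iteratedFDeriv_le_sum hNC k n
  refine ⟨l.map (N * ·), fun m hm => ?_, C, hC, fun f => ?_⟩
  · obtain ⟨a, ha, rfl⟩ := List.mem_map.1 hm
    exact mul_mem hN (hl a ha)
  have h0 : 0 ≤ ((l.map (N * ·)).map fun m => ‖(m f).toLp 2‖).sum := List.sum_nonneg (by simp)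
  refine seminorm_le_bound ℂ k n f (mul_nonneg hC h0) fun x => (hb f x).trans_eq ?_
  rw [List.sum_map_mul_left, List.map_map]
  rfl

lemma exists_norm_le_sum_norm_toLp (u : TD2) :
    ∃ l : List End2, (∀ m ∈ l, m ∈ HasTranspose) ∧ ∃ C : ℝ, 0 ≤ C ∧ ∀ f : S2,
      ‖u f‖ ≤ C * (l.map fun m => ‖(m f).toLp 2‖).sum := by
  obtain ⟨s, C, -, h⟩ := Seminorm.bound_of_continuous (schwartz_withSeminorms ℂ (ℝ × ℝ) ℂ)
    ((normSeminorm ℂ ℂ).comp (u : S2 →ₗ[ℂ] ℂ)) (continuous_norm.comp u.continuous)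
  have key : ∃ l : List End2, (∀ m ∈ l, m ∈ HasTranspose) ∧ ∃ C : ℝ, 0 ≤ C ∧ ∀ f : S2,
      s.sup (schwartzSeminormFamily ℂ (ℝ × ℝ) ℂ) f ≤
        C * (l.map fun m => ‖(m f).toLp 2‖).sum := by
    clear h
    induction s using Finset.induction_on with
    | empty => exact ⟨[], by simp, 0, le_rfl, by simp⟩
    | insert i s _ ih =>
      obtain ⟨l, hl, C, hC, h⟩ := ih
      obtain ⟨l', hl', C', hC', h'⟩ := exists_seminorm_le_sum_norm_toLp i.1 i.2
      refine ⟨l ++ l', fun m hm => (List.mem_append.1 hm).elim (hl m) (hl' m), C + C',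
        by positivity, fun f => ?_⟩
      have h1 : 0 ≤ (l.map fun m => ‖(m f).toLp 2‖).sum := List.sum_nonneg (by simp)
      have h2 : 0 ≤ (l'.map fun m => ‖(m f).toLp 2‖).sum := List.sum_nonneg (by simp)
      rw [Finset.sup_insert, List.map_append, List.sum_append]
      refine max_le ((h' f).trans ?_) ((h f).trans ?_)
      · gcongr <;> linarith
      · gcongr <;> linarith
  obtain ⟨l, hl, C', hC', h'⟩ := key
  refine ⟨l, hl, C * C', by positivity, fun f => (h f).trans ?_⟩
  rw [mul_assoc]
  exact mul_le_mul_of_nonneg_left (h' f) C.2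
/-- A linear functional bounded by norms of finitely many operators factors through them. -/
lemma exists_eq_sum_of_norm_le_sum {ι E F : Type*} [Fintype ι] [AddCommGroup E] [Module ℂ E]
    [NormedAddCommGroup F] [NormedSpace ℂ F] (u : E →ₗ[ℂ] ℂ) (T : ι → E →ₗ[ℂ] F) (C : ℝ)
    (h : ∀ f, ‖u f‖ ≤ C * ∑ i, ‖T i f‖) :
    ∃ v : ι → F →L[ℂ] ℂ, ∀ f, u f = ∑ i, v i (T i f) := by
  classical
  have hC : ∀ f, ‖u f‖ ≤ (|C| * Fintype.card ι) * ‖LinearMap.pi T f‖ := fun f => by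
    calc ‖u f‖ ≤ |C| * ∑ i, ‖T i f‖ := (h f).trans
          (mul_le_mul_of_nonneg_right (le_abs_self C) (Finset.sum_nonneg fun _ _ => norm_nonneg _))
      _ ≤ |C| * ∑ _i : ι, ‖LinearMap.pi T f‖ := by
          gcongr with i
          exact norm_le_pi_norm (LinearMap.pi T f) i
      _ = _ := by simp [mul_assoc]
  have hker : LinearMap.ker (LinearMap.pi T) ≤ LinearMap.ker u := fun f hf => by
    have h0 := hC f
    rw [LinearMap.mem_ker.1 hf, norm_zero, mul_zero] at h0
    exact norm_le_zero_iff.1 h0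
  let e := (LinearMap.pi T).quotKerEquivRange
  let u₀ : LinearMap.range (LinearMap.pi T) →ₗ[ℂ] ℂ :=
    (LinearMap.ker (LinearMap.pi T)).liftQ u hker ∘ₗ e.symm.toLinearMap
  have hu₀ : ∀ f, u₀ ⟨LinearMap.pi T f, f, rfl⟩ = u f := fun f => by
    have : e.symm ⟨LinearMap.pi T f, f, rfl⟩ = (LinearMap.ker (LinearMap.pi T)).mkQ f :=
      (LinearEquiv.symm_apply_eq e).2 rfl
    change (LinearMap.ker (LinearMap.pi T)).liftQ u hker (e.symm _) = _
    rw [this]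
    rfl
  obtain ⟨w, hw, -⟩ := exists_extension_norm_eq _ (u₀.mkContinuous (|C| * Fintype.card ι) (by
    rintro ⟨_, f, rfl⟩
    rw [hu₀]
    exact hC f))
  refine ⟨fun i => w.comp (ContinuousLinearMap.single ℂ (fun _ => F) i), fun f => ?_⟩
  have h₁ := hw ⟨LinearMap.pi T f, f, rfl⟩
  rw [LinearMap.mkContinuous_apply, hu₀] at h₁
  rw [← h₁]
  simp only [ContinuousLinearMap.comp_apply, ← map_sum]
  congr 1
  exact (Finset.univ_sum_single (LinearMap.pi T f)).symm

/-- The tempered distributions given by Schwartz functions. -/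
def schwartzFunctionals : Submodule ℂ TD2 where
  carrier := {u | InSchwartz u}
  zero_mem' := ⟨0, fun φ => by simp⟩
  add_mem' := by
    rintro u v ⟨f, hf⟩ ⟨g, hg⟩
    refine ⟨f + g, fun φ => ?_⟩
    have h : ∀ x, (f + g) x * φ x = f x * φ x + g x * φ x := fun x => add_mul ..
    simp only [h]
    rw [integral_add (integrable_mul_schwartz f φ) (integrable_mul_schwartz g φ), ← hf, ← hg]
    rfl
  smul_mem' := by
    rintro c u ⟨f, hf⟩
    refine ⟨c • f, fun φ => ?_⟩
    have h : ∀ x, (c • f) x * φ x = c * (f x * φ x) := fun x => mul_assoc ..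
    simp only [h]
    rw [integral_const_mul, ← hf]
    rfl

lemma comp_toLpCLM_comp_mem_closure (v : Lp ℂ 2 (volume : Measure (ℝ × ℝ)) →L[ℂ] ℂ) {m : End2}
    (hm : m ∈ HasTranspose) :
    v.comp ((toLpCLM ℂ ℂ 2 volume).comp m) ∈ schwartzFunctionals.topologicalClosure := by
  obtain ⟨B, hB⟩ := hm
  let Φ : Lp ℂ 2 (volume : Measure (ℝ × ℝ)) → TD2 := fun g =>
    ContinuousLinearMap.precomp ℂ ((toLpCLM ℂ ℂ 2 volume).comp m)
      (InnerProductSpace.toDual ℂ (Lp ℂ 2 (volume : Measure (ℝ × ℝ))) g)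
  have hΦ : Continuous Φ := (ContinuousLinearMap.continuous _).comp
    (LinearIsometryEquiv.continuous _)
  obtain ⟨g, rfl⟩ := (InnerProductSpace.toDual ℂ (Lp ℂ 2 (volume : Measure (ℝ × ℝ)))).surjective v
  refine map_mem_closure (f := Φ) (s := Set.range (toLpCLM ℝ ℂ 2 volume)) hΦ
    (denseRange_toLpCLM (by simp) g) ?_
  rintro _ ⟨f, rfl⟩
  let fc : S2 := postcompCLM (Complex.conjCLE : ℂ →L[ℝ] ℂ) f
  refine ⟨B fc, fun φ => ?_⟩
  have h₁ : Φ (toLpCLM ℝ ℂ 2 volume f) φ = inner ℂ (f.toLp 2 volume) ((m φ).toLp 2 volume) := rfl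
  rw [h₁, hB.symm fc φ]
  refine (inner_toL2_toL2_eq f (m φ) volume).trans (integral_congr_ae (.of_forall fun x => ?_))
  exact mul_comm _ _

lemma mem_closure_schwartzFunctionals (u : TD2) : u ∈ schwartzFunctionals.topologicalClosure := by
  obtain ⟨l, hl, C, -, h⟩ := exists_norm_le_sum_norm_toLp u
  let T : Fin l.length → S2 →ₗ[ℂ] Lp ℂ 2 (volume : Measure (ℝ × ℝ)) :=
    fun i => (toLpCLM ℂ ℂ 2 volume).comp (l.get i)
  obtain ⟨v, hv⟩ := exists_eq_sum_of_norm_le_sum (u : S2 →ₗ[ℂ] ℂ) T C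
    (fun f => (h f).trans_eq (by
      rw [← Fin.sum_univ_fun_getElem]
      rfl))
  have hu : u = ∑ i : Fin l.length, (v i).comp ((toLpCLM ℂ ℂ 2 volume).comp (l.get i)) := by
    ext f
    rw [sum_apply]
    exact hv f
  rw [hu]
  exact Submodule.sum_mem _ fun i _ => comp_toLpCLM_comp_mem_closure (v i) (hl _ (l.get_mem i))

lemma eq_precomp_of_repBy {A B : End2} (hAB : IsTranspose A B) {Q : TD2 →L[ℂ] TD2}
    (hQ : ∀ (f : S2) (u : TD2), RepBy u f → RepBy (Q u) (A f)) (u : TD2) : Q u = u.comp B := by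
  have h : Set.EqOn Q (ContinuousLinearMap.precomp ℂ B) (closure schwartzFunctionals) := by
    refine Set.EqOn.closure ?_ Q.continuous (ContinuousLinearMap.continuous _)
    rintro u ⟨f, hf⟩
    refine ContinuousLinearMap.ext fun φ => ?_
    rw [hQ f u hf φ, hAB f φ]
    exact (hf (B φ)).symm
  exact h (mem_closure_schwartzFunctionals u)

theorem statement8 (P : MvPolynomial (Fin 2) ℝ) (q : MvPolynomial (Fin 2) ℂ)
    (hq : ∀ ξ : ℝ × ℝ, qval q ξ ≠ 0)
    (Q1' : TD2 →L[ℂ] TD2) (hQ1' : ExtendsOp Q1' (Qrep1 q P)) :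
    Function.Bijective Q1' ∧ RegularTD Q1' ∧
      ∀ f : 𝓢(ℝ × ℝ, ℂ), ∃ g : 𝓢(ℝ × ℝ, ℂ), ⇑g = Qrep1 q P ⇑f := by
  obtain ⟨A, ⟨hAu, B, hBu, hAB⟩, hAq⟩ := exists_end_eq_Qrep1 P hq
  obtain ⟨A', hA⟩ := hAu.exists_right_inv
  obtain ⟨B', hB⟩ := hBu.exists_right_inv
  have hB' : B' * B = 1 := by
    obtain ⟨B'', hB''⟩ := hBu.exists_left_inv
    rwa [← left_inv_eq_right_inv hB'' hB]
  have hQ : ∀ u, Q1' u = u.comp B := eq_precomp_of_repBy hAB fun f u hf => by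
    rw [hAq]
    exact hQ1' f u hf
  have hBB' : ∀ φ, B (B' φ) = φ := fun φ => congrArg (fun T : End2 => T φ) hB
  refine ⟨⟨fun u v huv => ?_, fun u => ⟨u.comp B', ?_⟩⟩, ?_, fun f => ⟨A f, hAq f⟩⟩
  · refine ContinuousLinearMap.ext fun φ => ?_
    rw [hQ, hQ] at huv
    rw [← hBB' φ]
    exact congrArg (fun T : TD2 => T (B' φ)) huv
  · rw [hQ]
    exact ContinuousLinearMap.ext fun φ => congrArg u (congrArg (fun T : End2 => T φ) hB')
  · rintro u ⟨g, hg⟩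
    refine ⟨A' g, fun φ => ?_⟩
    have hAA' : A (A' g) = g := congrArg (fun T : End2 => T g) hA
    have h₁ : u φ = Q1' u (B' φ) := by
      rw [hQ, ContinuousLinearMap.comp_apply, hBB']
    have h₂ := hAB (A' g) (B' φ)
    rw [hAA', hBB'] at h₂
    rw [h₁, hg, h₂]
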